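/- arXiv:math/0004137 — 2 statements merged into one kernel-verified Lean document; each statement's English description precedes it below -/
import Mathlib

section
/- (Coproduct rule, single-variable form) For every partition ν and all integers p ≥ 1 and q ≥ 1, the identity G_ν(x_1,…,x_p,z_1,…,z_q) = Σ_{λ,μ} d^ν_{λμ}·G_λ(x_1,…,x_p)·G_μ(z_1,…,z_q) holds in ℤ[x_1,…,x_p,z_1,…,z_q], where on the left G_ν is the stable Grothendieck polynomial in the p+q variables x_1,…,x_p,z_1,…,z_q, and the sum is over all pairs of partitions (λ,μ) (only finitely many terms being nonzero). -/
open MvPolynomial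

/-- A set-valued tableau on an arbitrary finite set of boxes `(row, column)`.
Entries are `0`-based: the entry `i : ℕ` stands for the integer `i + 1`
(equivalently, for the variable `x_{i+1}`).  Rows weakly increase from left to
right and columns strictly increase from top to bottom, expressed via
horizontally and vertically adjacent boxes. -/
structure SVT (cells : Finset (ℕ × ℕ)) where
  entry : ℕ × ℕ → Finset ℕ
  nonempty_of_mem : ∀ c ∈ cells, (entry c).Nonempty
  eq_empty_of_not_mem : ∀ c, c ∉ cells → entry c = ∅
  row_weak : ∀ i j, (i, j) ∈ cells → (i, j + 1) ∈ cells →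
    ∀ a ∈ entry (i, j), ∀ b ∈ entry (i, j + 1), a ≤ b
  col_strict : ∀ i j, (i, j) ∈ cells → (i + 1, j) ∈ cells →
    ∀ a ∈ entry (i, j), ∀ b ∈ entry (i + 1, j), a < b

namespace SVT

variable {cells : Finset (ℕ × ℕ)}

/-- `|T|`: the total number of integers in the boxes of `T`. -/
def size (T : SVT cells) : ℕ := ∑ c ∈ cells, (T.entry c).card

/-- `T` has all its entries among `{1, …, m}` (i.e. `0`-based entries `< m`). -/
def Bounded (T : SVT cells) (m : ℕ) : Prop := ∀ c, ∀ x ∈ T.entry c, x < m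

/-- The monomial `x^T`, where the exponent of the variable `i` is the number of
boxes of `T` containing `i`. -/
noncomputable def monomial (T : SVT cells) : MvPolynomial ℕ ℤ :=
  ∏ c ∈ cells, ∏ i ∈ T.entry c, X i

/-- The column word of `T`: columns are read from left to right, each column
from bottom to top, the integers within a box in increasing order. -/
def word (T : SVT cells) : List ℕ :=
  (List.range ((cells.sup fun c => max c.1 c.2) + 1)).flatMap fun j =>
    ((List.range ((cells.sup fun c => max c.1 c.2) + 1)).reverse).flatMap fun i =>
      (T.entry (i, j)).sort (· ≤ ·)

end SVT

/-- The stable Grothendieck polynomial of the shape given by `cells`, in the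
variables `x_1, …, x_m` (`0`-based: variables `0, …, m-1`):
`G(cells) = ∑_T (-1)^(|T| - #cells) x^T` over set-valued tableaux `T` of shape
`cells` with entries in `{1, …, m}`. -/
noncomputable def grothendieck (cells : Finset (ℕ × ℕ)) (m : ℕ) : MvPolynomial ℕ ℤ :=
  ∑ᶠ (T : SVT cells) (_ : T.Bounded m), ((-1 : ℤ) ^ (T.size - cells.card)) • T.monomial

/-- A reverse lattice word: every suffix contains, for each `i`, at least as
many occurrences of `i` as of `i + 1`. -/
def IsRLW (w : List ℕ) : Prop := ∀ s, s <:+ w → ∀ i, s.count (i + 1) ≤ s.count i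

/-- A partial reverse lattice word with respect to the (`0`-based, half-open)
interval `[a, b)`:  every suffix contains, for each `t` with `a ≤ t` and
`t + 1 < b`, at least as many occurrences of `t` as of `t + 1`. -/
def IsPartialRLW (a b : ℕ) (w : List ℕ) : Prop :=
  ∀ s, s <:+ w → ∀ t, a ≤ t → t + 1 < b → s.count (t + 1) ≤ s.count t

/-- `w` has content `ν`: the number of occurrences of `i` in `w` is the length
of the `i`-th row of `ν`. -/
def HasContent (w : List ℕ) (nu : YoungDiagram) : Prop := ∀ i, w.count i = nu.rowLen i

/-- The cells of the skew diagram `λ * μ`, obtained by placing `λ` and `μ`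
corner to corner: `λ` occupies rows `0, …, ℓ(λ)-1` shifted right by `μ₁`
columns, and `μ` occupies the rows below row `ℓ(λ)-1`. -/
def starCells (lam mu : YoungDiagram) : Finset (ℕ × ℕ) :=
  (lam.cells.image fun c => (c.1, c.2 + mu.rowLen 0)) ∪
    (mu.cells.image fun c => (c.1 + lam.colLen 0, c.2))

/-- The structure constant `c^ν_{λμ}`: `(-1)^(|ν|-|λ|-|μ|)` times the number of
set-valued tableaux of shape `λ * μ` whose word is a reverse lattice word with
content `ν`. -/
noncomputable def cLR (lam mu nu : YoungDiagram) : ℤ :=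
  (-1 : ℤ) ^ (nu.card - lam.card - mu.card) *
    (Nat.card {T : SVT (starCells lam mu) // IsRLW T.word ∧ HasContent T.word nu} : ℤ)

/-- The coproduct structure constant `d^ν_{λμ}`: `(-1)^(|λ|+|μ|-|ν|)` times the
number of set-valued tableaux of shape `ν` whose word is a partial reverse
lattice word with respect to both intervals `[1, ℓ(λ)]` and
`[ℓ(λ)+1, ℓ(λ)+ℓ(μ)]` and has content `(λ₁, …, λ_{ℓ(λ)}, μ₁, …, μ_{ℓ(μ)})`. -/
noncomputable def dCoeff (lam mu nu : YoungDiagram) : ℤ :=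
  (-1 : ℤ) ^ (lam.card + mu.card - nu.card) *
    (Nat.card {T : SVT nu.cells //
      IsPartialRLW 0 (lam.colLen 0) T.word ∧
      IsPartialRLW (lam.colLen 0) (lam.colLen 0 + mu.colLen 0) T.word ∧
      ∀ i, T.word.count i =
        if i < lam.colLen 0 then lam.rowLen i else mu.rowLen (i - lam.colLen 0)} : ℤ)

/-- The coefficient `α_{θ,μ}` for a shape `θ` given by `cells`:
`(-1)^(|μ|-|θ|)` times the number of set-valued tableaux of shape `θ` whose
word is a reverse lattice word with content `μ`. -/
noncomputable def alphaCoeff (cells : Finset (ℕ × ℕ)) (mu : YoungDiagram) : ℤ :=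
  (-1 : ℤ) ^ (mu.card - cells.card) *
    (Nat.card {T : SVT cells // IsRLW T.word ∧ HasContent T.word mu} : ℤ)

/-- `ν/λ` is a vertical strip: at most one box in each row. -/
def IsVerticalStrip (lam nu : YoungDiagram) : Prop := ∀ i, nu.rowLen i ≤ lam.rowLen i + 1

/-- `ν/λ` is a horizontal strip: at most one box in each column. -/
def IsHorizontalStrip (lam nu : YoungDiagram) : Prop := ∀ j, nu.colLen j ≤ lam.colLen j + 1

/-- A set of boxes is a rook strip if it has at most one box in each row and in
each column. -/
def IsRookStripCells (s : Finset (ℕ × ℕ)) : Prop :=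
  (∀ i, (s.filter fun c => c.1 = i).card ≤ 1) ∧ (∀ j, (s.filter fun c => c.2 = j).card ≤ 1)

/-- The rectangular Young diagram with `p` rows and `q` columns. -/
def rect (p q : ℕ) : YoungDiagram :=
  ⟨Finset.range p ×ˢ Finset.range q, by
    intro a b hba ha
    simp only [Finset.coe_product, Set.mem_prod, Finset.mem_coe, Finset.mem_range] at ha ⊢
    exact ⟨lt_of_le_of_lt hba.1 ha.1, lt_of_le_of_lt hba.2 ha.2⟩⟩

/-- The polynomials that the K-theoretic antisymmetrizer kills: sums of `g` such that
`x_k (1 - x_{k+1}) g` is symmetric in `x_k, x_{k+1}` for some `k ∈ K`. -/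
noncomputable def nullPolys (K : Set ℕ) : AddSubgroup (MvPolynomial ℕ ℤ) :=
  AddSubgroup.closure {g | ∃ k ∈ K, rename (Equiv.swap k (k + 1)) (X k * (1 - X (k + 1)) * g) =
    X k * (1 - X (k + 1)) * g}

lemma nullPolys_mono {K L : Set ℕ} (h : K ⊆ L) : nullPolys K ≤ nullPolys L :=
  AddSubgroup.closure_mono fun _ ⟨k, hk, e⟩ => ⟨k, h hk, e⟩

lemma mul_mem_nullPolys {K : Set ℕ} {g h : MvPolynomial ℕ ℤ} (hg : g ∈ nullPolys K)
    (hh : ∀ k ∈ K, rename (Equiv.swap k (k + 1)) h = h) : h * g ∈ nullPolys K := by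
  induction hg using AddSubgroup.closure_induction with
  | mem x hx =>
    obtain ⟨k, hk, e⟩ := hx
    refine AddSubgroup.subset_closure ⟨k, hk, ?_⟩
    rw [show X k * (1 - X (k + 1)) * (h * x) = h * (X k * (1 - X (k + 1)) * x) by ring,
      map_mul, e, hh k hk]
  | zero => simp [zero_mem]
  | add x y _ _ hx hy => rw [mul_add]; exact add_mem hx hy
  | neg x _ hx => rw [mul_neg]; exact neg_mem hx

lemma rename_add_mem_nullPolys {K L : Set ℕ} (p : ℕ) (hKL : ∀ k ∈ K, k + p ∈ L)
    {g : MvPolynomial ℕ ℤ} (hg : g ∈ nullPolys K) : rename (· + p) g ∈ nullPolys L := by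
  induction hg using AddSubgroup.closure_induction with
  | mem x hx =>
    obtain ⟨k, hk, e⟩ := hx
    refine AddSubgroup.subset_closure ⟨k + p, hKL k hk, ?_⟩
    have hc : (Equiv.swap (k + p) (k + p + 1) : ℕ → ℕ) ∘ (· + p) =
        (· + p) ∘ (Equiv.swap k (k + 1) : ℕ → ℕ) := by
      funext i
      simp only [Function.comp, Equiv.swap_apply_def]
      split_ifs <;> omega
    have := congrArg (rename (· + p)) e
    rw [rename_rename, ← hc, ← rename_rename] at this
    simpa [add_right_comm] using this
  | zero => simp [zero_mem]
  | add x y _ _ hx hy => rw [map_add]; exact add_mem hx hy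
  | neg x _ hx => rw [map_neg]; exact neg_mem hx

lemma prod_range_swap {M : Type*} [CommMonoid M] {m k : ℕ} (hk : k + 1 < m) (f : ℕ → M) :
    ∏ i ∈ Finset.range m, f (Equiv.swap k (k + 1) i) = ∏ i ∈ Finset.range m, f i := by
  refine Finset.prod_equiv (Equiv.swap k (k + 1)) (fun i => ?_) (fun _ _ => rfl)
  simp only [Finset.mem_range, Equiv.swap_apply_def]
  split_ifs <;> omega

lemma eq_one_of_apply_le {m : ℕ} (w : Equiv.Perm {i // i ∈ Finset.range m})
    (h : ∀ i, w i ≤ i) : w = 1 := by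
  suffices ∀ n (hn : n ∈ Finset.range m), w ⟨n, hn⟩ = ⟨n, hn⟩ from Equiv.ext fun i => this i.1 i.2
  intro n
  induction n using Nat.strong_induction_on with
  | _ n ih =>
    intro hn
    have h1 := h ⟨n, hn⟩
    by_contra hne
    have hlt : (w ⟨n, hn⟩).1 < n := lt_of_le_of_ne h1 fun e => hne (Subtype.ext e)
    exact hne (w.injective (ih _ hlt (w ⟨n, hn⟩).2))

/-- The numerator `x^ρ ∏ (1 - x_i)^i` of the K-theoretic Weyl formula. -/
noncomputable def weylNumerator (m : ℕ) : MvPolynomial ℕ ℤ :=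
  ∏ i ∈ Finset.range m, (X i ^ (m - 1 - i) * (1 - X i) ^ i)

lemma rename_swap_weylNumerator_mul {m k : ℕ} (hk : k + 1 < m) {g : MvPolynomial ℕ ℤ}
    (hg : rename (Equiv.swap k (k + 1)) (X k * (1 - X (k + 1)) * g) =
      X k * (1 - X (k + 1)) * g) :
    rename (Equiv.swap k (k + 1)) (weylNumerator m * g) = weylNumerator m * g := by
  set D : MvPolynomial ℕ ℤ := ∏ i ∈ Finset.range m,
    (X i ^ (if i = k then m - 2 - k else m - 1 - i) * (1 - X i) ^ (if i = k + 1 then k else i))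
    with hD
  have hDs : rename (Equiv.swap k (k + 1)) D = D := by
    rw [hD, map_prod]
    simp only [map_mul, map_pow, map_sub, map_one, rename_X]
    rw [← prod_range_swap hk]
    refine Finset.prod_congr rfl fun i _ => ?_
    rw [Equiv.swap_apply_self]
    have h1 : (if Equiv.swap k (k + 1) i = k then m - 2 - k else m - 1 - Equiv.swap k (k + 1) i) =
        (if i = k then m - 2 - k else m - 1 - i) := by
      simp only [Equiv.swap_apply_def]
      split_ifs <;> omega
    have h2 : (if Equiv.swap k (k + 1) i = k + 1 then k else Equiv.swap k (k + 1) i) =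
        (if i = k + 1 then k else i) := by
      simp only [Equiv.swap_apply_def]
      split_ifs <;> omega
    rw [h1, h2]
  have hW : weylNumerator m = D * (X k * (1 - X (k + 1))) := by
    have e : (X k : MvPolynomial ℕ ℤ) * (1 - X (k + 1)) = ∏ i ∈ Finset.range m,
        ((if i = k then X i else 1) * (if i = k + 1 then (1 - X i) else 1)) := by
      rw [Finset.prod_mul_distrib, Finset.prod_ite_eq', Finset.prod_ite_eq',
        if_pos (by simp; omega), if_pos (by simp; omega)]
    rw [e, hD, ← Finset.prod_mul_distrib, weylNumerator]
    refine Finset.prod_congr rfl fun i _ => ?_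
    rcases eq_or_ne i k with rfl | h1
    · rw [show m - 1 - i = m - 2 - i + 1 by omega]; simp [pow_succ]; ring
    · rcases eq_or_ne i (k + 1) with rfl | h2
      · simp [pow_succ]; ring
      · simp [h1, h2]
  rw [hW, mul_assoc, map_mul, hg, hDs]

/-- The signed sum of the permutations in `H` is nonzero on the Weyl numerator. -/
lemma sum_sign_weylNumerator_ne_zero {m : ℕ} (H : Finset (Equiv.Perm {i // i ∈ Finset.range m}))
    (hH : 1 ∈ H) :
    ∑ w ∈ H, (Equiv.Perm.sign w : ℤ) • rename (Equiv.Perm.ofSubtype w) (weylNumerator m) ≠ 0 := by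
  set ρ : ℕ →₀ ℕ := Finsupp.onFinset (Finset.range m) (fun i => m - 1 - i)
    (fun i hi => by simp; omega) with hρ
  set E : MvPolynomial ℕ ℤ := ∏ i ∈ Finset.range m, (1 - X i) ^ i with hE
  have hD : weylNumerator m = monomial ρ 1 * E := by
    rw [weylNumerator, Finset.prod_mul_distrib, hE, monomial_eq, Finsupp.prod_of_support_subset
      (s := Finset.range m)]
    · simp [hρ]
    · exact Finsupp.support_onFinset_subset
    · simp
  have hcoeff : coeff ρ (∑ w ∈ H, (Equiv.Perm.sign w : ℤ) •
      rename (Equiv.Perm.ofSubtype w) (weylNumerator m)) = 1 := by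
    rw [coeff_sum, Finset.sum_eq_single_of_mem 1 hH]
    · have : coeff 0 E = 1 := by
        rw [← constantCoeff_eq, hE, map_prod]; simp
      simp [hD, coeff_monomial_mul', this]
    · intro w _ hw
      rw [coeff_smul, hD, map_mul, rename_monomial, coeff_monomial_mul', if_neg, smul_zero]
      intro hle
      refine hw (eq_one_of_apply_le w fun i => ?_)
      have h1 := hle (Equiv.Perm.ofSubtype w i)
      rw [Finsupp.mapDomain_apply (Equiv.injective _), Equiv.Perm.ofSubtype_apply_coe] at h1
      simp only [hρ, Finsupp.onFinset_apply] at h1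
      have h2 := Finset.mem_range.1 i.2
      have h3 := Finset.mem_range.1 (w i).2
      exact Subtype.coe_le_coe.1 (by omega)
  intro h0
  rw [h0] at hcoeff
  simp at hcoeff

/-- A symmetric polynomial in `nullPolys` vanishes. -/
theorem eq_zero_of_mem_nullPolys {m : ℕ} {K : Set ℕ} (hK : ∀ k ∈ K, k + 1 < m)
    {f : MvPolynomial ℕ ℤ} (hf : f ∈ nullPolys K)
    (hsymm : ∀ k ∈ K, rename (Equiv.swap k (k + 1)) f = f) : f = 0 := by
  classical
  set H : Finset (Equiv.Perm {i // i ∈ Finset.range m}) :=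
    Finset.univ.filter fun w => rename (Equiv.Perm.ofSubtype w) f = f with hH
  set A : MvPolynomial ℕ ℤ → MvPolynomial ℕ ℤ := fun g => ∑ w ∈ H, (Equiv.Perm.sign w : ℤ) •
    rename (Equiv.Perm.ofSubtype w) (weylNumerator m * g) with hA
  have hnull : A f = 0 := by
    suffices ∀ g ∈ nullPolys K, A g = 0 from this f hf
    intro g hg
    induction hg using AddSubgroup.closure_induction with
    | mem x hx =>
      obtain ⟨k, hk, e⟩ := hx
      have hkm := hK k hk
      set s : Equiv.Perm {i // i ∈ Finset.range m} := Equiv.swap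
        ⟨k, Finset.mem_range.2 (by omega)⟩ ⟨k + 1, Finset.mem_range.2 hkm⟩ with hs
      have hs' : Equiv.Perm.ofSubtype s = Equiv.swap k (k + 1) := by
        rw [hs, Equiv.Perm.ofSubtype_swap_eq]
      have hmul : ∀ (w : Equiv.Perm {i // i ∈ Finset.range m}) (g : MvPolynomial ℕ ℤ),
          rename (Equiv.Perm.ofSubtype (w * s)) g =
            rename (Equiv.Perm.ofSubtype w) (rename (Equiv.swap k (k + 1)) g) := by
        intro w g
        rw [rename_rename, ← hs', ← Equiv.Perm.coe_mul, map_mul]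
      have hss : s * s = 1 := Equiv.swap_mul_self _ _
      refine Finset.sum_involution (fun w _ => w * s) ?_ ?_ ?_ ?_
      · intro w _
        rw [hmul, rename_swap_weylNumerator_mul hkm e, map_mul,
          Equiv.Perm.sign_mul, hs, Equiv.Perm.sign_swap (by simp)]
        simp
      · intro w _ _ h
        have : s = 1 := by simpa using h
        have h2 := congrArg (fun w => (w ⟨k, Finset.mem_range.2 (by omega)⟩).1) this
        simp [hs] at h2
      · intro w hw
        simp only [hH, Finset.mem_filter, Finset.mem_univ, true_and] at hw ⊢
        rw [hmul, hsymm k hk, hw]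
      · intro w _
        rw [mul_assoc, hss, mul_one]
    | zero => simp [hA]
    | add x y _ _ hx hy =>
      simp only [hA, mul_add, map_add, smul_add, Finset.sum_add_distrib] at hx hy ⊢
      rw [hx, hy, add_zero]
    | neg x _ hx =>
      simp only [hA, mul_neg, map_neg, smul_neg, Finset.sum_neg_distrib] at hx ⊢
      rw [hx, neg_zero]
  have hfac : A f = f * ∑ w ∈ H, (Equiv.Perm.sign w : ℤ) •
      rename (Equiv.Perm.ofSubtype w) (weylNumerator m) := by
    rw [hA, Finset.mul_sum]
    refine Finset.sum_congr rfl fun w hw => ?_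
    rw [map_mul, (Finset.mem_filter.1 hw).2, mul_smul_comm, mul_comm]
  rw [hnull] at hfac
  exact (mul_eq_zero.1 hfac.symm).resolve_right
    (sum_sign_weylNumerator_ne_zero H (by simp [hH, rename_id]))

/-- Reflection of the integers satisfying `P` below `n`, in case these form an interval. -/
noncomputable def mirror (P : ℕ → Prop) (n j : ℕ) : ℕ :=
  sInf {i | i < n ∧ P i} + sSup {i | i < n ∧ P i} - j

section Mirror

variable {P : ℕ → Prop} {n j : ℕ}

lemma sInf_le_and_le_sSup (hj : j < n) (hP : P j) :
    sInf {i | i < n ∧ P i} ≤ j ∧ j ≤ sSup {i | i < n ∧ P i} :=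
  ⟨Nat.sInf_le ⟨hj, hP⟩, le_csSup ⟨n, fun _ h => h.1.le⟩ ⟨hj, hP⟩⟩

lemma mirror_mem (hconv : ∀ a b c, a < b → b < c → P a → P c → P b) (hj : j < n) (hP : P j) :
    mirror P n j < n ∧ P (mirror P n j) := by
  obtain ⟨h1, h2⟩ := sInf_le_and_le_sSup hj hP
  obtain ⟨hl, hl'⟩ := Nat.sInf_mem (s := {i | i < n ∧ P i}) ⟨j, hj, hP⟩
  obtain ⟨hr, hr'⟩ := Nat.sSup_mem (s := {i | i < n ∧ P i}) ⟨j, hj, hP⟩ ⟨n, fun _ h => h.1.le⟩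
  rw [mirror]
  set l := sInf {i | i < n ∧ P i}
  set r := sSup {i | i < n ∧ P i}
  refine ⟨by omega, ?_⟩
  rcases Nat.lt_or_ge l (l + r - j) with h3 | h3
  · rcases Nat.lt_or_ge (l + r - j) r with h4 | h4
    · exact hconv _ _ _ h3 h4 hl' hr'
    · rwa [show l + r - j = r by omega]
  · rwa [show l + r - j = l by omega]

lemma mirror_mirror (hj : j < n) (hP : P j) : mirror P n (mirror P n j) = j := by
  obtain ⟨h1, h2⟩ := sInf_le_and_le_sSup hj hP
  simp only [mirror]
  omega

lemma mirror_eq_succ (hj : j + 1 < n) (hP : P (j + 1)) :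
    mirror P n j = mirror P n (j + 1) + 1 := by
  obtain ⟨h1, h2⟩ := sInf_le_and_le_sSup hj hP
  simp only [mirror]
  omega

end Mirror

namespace SVT

lemma ext_entry {cells : Finset (ℕ × ℕ)} {T T' : SVT cells} (h : ∀ c, T.entry c = T'.entry c) :
    T = T' := by
  cases T; cases T'; congr; exact funext h

lemma mem_cells {cells : Finset (ℕ × ℕ)} (T : SVT cells) {c : ℕ × ℕ} {a : ℕ}
    (h : a ∈ T.entry c) : c ∈ cells := by
  by_contra hc
  simp [T.eq_empty_of_not_mem c hc] at h

variable {nu : YoungDiagram} (T : SVT nu.cells)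

variable {T} in
lemma row_mono {i j j' a b : ℕ} (hj : j < j') (ha : a ∈ T.entry (i, j))
    (hb : b ∈ T.entry (i, j')) : a ≤ b := by
  induction j', hj using Nat.le_induction generalizing b with
  | base => exact T.row_weak i j (T.mem_cells ha) (T.mem_cells hb) a ha b hb
  | succ n hn ih =>
    have hc : (i, n) ∈ nu.cells :=
      nu.isLowerSet (by simp : ((i, n) : ℕ × ℕ) ≤ (i, n + 1)) (T.mem_cells hb)
    obtain ⟨x, hx⟩ := T.nonempty_of_mem _ hc
    exact (ih hx).trans (T.row_weak i n hc (T.mem_cells hb) x hx b hb)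

variable {T} in
lemma col_mono {i i' j a b : ℕ} (hi : i < i') (ha : a ∈ T.entry (i, j))
    (hb : b ∈ T.entry (i', j)) : a < b := by
  induction i', hi using Nat.le_induction generalizing b with
  | base => exact T.col_strict i j (T.mem_cells ha) (T.mem_cells hb) a ha b hb
  | succ n hn ih =>
    have hc : (n, j) ∈ nu.cells :=
      nu.isLowerSet (by simp : ((n, j) : ℕ × ℕ) ≤ (n + 1, j)) (T.mem_cells hb)
    obtain ⟨x, hx⟩ := T.nonempty_of_mem _ hc
    exact (ih hx).trans (T.col_strict n j hc (T.mem_cells hb) x hx b hb)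

variable {T} in
lemma row_unique {i i' j a : ℕ} (h : a ∈ T.entry (i, j)) (h' : a ∈ T.entry (i', j)) :
    i = i' := by
  rcases lt_trichotomy i i' with hlt | heq | hlt
  · exact absurd (col_mono hlt h h') (lt_irrefl a)
  · exact heq
  · exact absurd (col_mono hlt h' h) (lt_irrefl a)

/-- The box `c` contains `k` or `k + 1`. -/
def Meets (k : ℕ) (c : ℕ × ℕ) : Prop := k ∈ T.entry c ∨ k + 1 ∈ T.entry c

/-- The box `(i, j)` contains `k` or `k + 1`, and no vertically adjacent box does. -/
def Free (k i j : ℕ) : Prop :=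
  T.Meets k (i, j) ∧ ¬ T.Meets k (i + 1, j) ∧ ∀ i', i' + 1 = i → ¬ T.Meets k (i', j)

variable {T} {k : ℕ}

lemma mem_of_meets_below {i j : ℕ} (h : T.Meets k (i, j)) (h' : T.Meets k (i + 1, j)) :
    k ∈ T.entry (i, j) ∧ k + 1 ∉ T.entry (i, j) ∧ k ∉ T.entry (i + 1, j) ∧
      k + 1 ∈ T.entry (i + 1, j) := by
  have key : ∀ a b, a ∈ T.entry (i, j) → b ∈ T.entry (i + 1, j) → a < b :=
    fun a b ha hb => col_mono (Nat.lt_succ_self i) ha hb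
  have h1 := key k k
  have h2 := key (k + 1) k
  have h3 := key (k + 1) (k + 1)
  simp only [Meets] at h h'
  grind

lemma meets_below_of_lt {i j j' : ℕ} (hj : j < j') (h : T.Meets k (i, j))
    (h' : T.Meets k (i, j')) (h'' : T.Meets k (i + 1, j')) : T.Meets k (i + 1, j) := by
  obtain ⟨a1, a2, -, a4⟩ := mem_of_meets_below h' h''
  have hk : k ∈ T.entry (i, j) := by
    rcases h with h | h
    · exact h
    · have := row_mono hj h a1; omega
  have hc : (i + 1, j) ∈ nu.cells :=
    nu.isLowerSet (by simp [hj.le] : ((i + 1, j) : ℕ × ℕ) ≤ (i + 1, j')) (T.mem_cells a4)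
  obtain ⟨x, hx⟩ := T.nonempty_of_mem _ hc
  have h1 := col_mono (Nat.lt_succ_self i) hk hx
  have h2 := row_mono hj hx a4
  obtain rfl : x = k + 1 := by omega
  exact Or.inr hx

lemma meets_above_of_lt {i j j' : ℕ} (hj : j < j') (h : T.Meets k (i, j))
    (h' : T.Meets k (i + 1, j)) (h'' : T.Meets k (i + 1, j')) : T.Meets k (i, j') := by
  obtain ⟨a1, -, -, a4⟩ := mem_of_meets_below h h'
  have hk : k + 1 ∈ T.entry (i + 1, j') := by
    rcases h'' with h | h
    · have := row_mono hj a4 h; omega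
    · exact h
  have hc : (i, j') ∈ nu.cells :=
    nu.isLowerSet (by simp : ((i, j') : ℕ × ℕ) ≤ (i + 1, j')) (T.mem_cells hk)
  obtain ⟨x, hx⟩ := T.nonempty_of_mem _ hc
  have h1 := col_mono (Nat.lt_succ_self i) hx hk
  have h2 := row_mono hj a1 hx
  obtain rfl : x = k := by omega
  exact Or.inl hx

lemma meets_between {i a b c : ℕ} (hab : a < b) (hbc : b < c) (ha : T.Meets k (i, a))
    (hc : T.Meets k (i, c)) : T.Meets k (i, b) := by
  have hcell : (i, b) ∈ nu.cells :=
    nu.isLowerSet (by simp [hbc.le] : ((i, b) : ℕ × ℕ) ≤ (i, c))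
      (hc.elim T.mem_cells T.mem_cells)
  obtain ⟨x, hx⟩ := T.nonempty_of_mem _ hcell
  have h1 : k ≤ x := by
    rcases ha with h | h <;> have := row_mono hab h hx <;> omega
  have h2 : x ≤ k + 1 := by
    rcases hc with h | h <;> have := row_mono hbc hx h <;> omega
  rcases Nat.lt_or_ge k x with h3 | h3
  · obtain rfl : x = k + 1 := by omega
    exact Or.inr hx
  · obtain rfl : x = k := by omega
    exact Or.inl hx

lemma free_convex (i a b c : ℕ) (hab : a < b) (hbc : b < c) (ha : T.Free k i a)
    (hc : T.Free k i c) : T.Free k i b := by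
  have hb := meets_between hab hbc ha.1 hc.1
  refine ⟨hb, fun h => ha.2.1 (meets_below_of_lt hab ha.1 hb h), ?_⟩
  rintro i' rfl h
  exact hc.2.2 i' rfl (meets_above_of_lt hbc h hb hc.1)

variable (T k)

open Classical in
/-- Entries of the Bender–Knuth reflection of `T` at `{k, k + 1}`, restricted to the columns
before column `n`. -/
noncomputable def flipEntry (n : ℕ) (c : ℕ × ℕ) : Finset ℕ :=
  if c.2 < n ∧ T.Free k c.1 c.2 then
    (T.entry c).filter (fun e => e ≠ k ∧ e ≠ k + 1) ∪
      ((T.entry (c.1, mirror (T.Free k c.1) n c.2)).filter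
        (fun e => e = k ∨ e = k + 1)).image (Equiv.swap k (k + 1))
  else T.entry c

variable {T k} {n : ℕ} {c : ℕ × ℕ}

lemma flipEntry_of_not (h : ¬ (c.2 < n ∧ T.Free k c.1 c.2)) : T.flipEntry k n c = T.entry c :=
  if_neg h

lemma mem_flipEntry_of_ne {e : ℕ} (h1 : e ≠ k) (h2 : e ≠ k + 1) :
    e ∈ T.flipEntry k n c ↔ e ∈ T.entry c := by
  rw [flipEntry]
  split_ifs
  · simp only [Finset.mem_union, Finset.mem_filter, Finset.mem_image]
    constructor
    · rintro (h | ⟨x, ⟨-, rfl | rfl⟩, rfl⟩)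
      · exact h.1
      · simp at h2
      · simp at h1
    · exact fun h => Or.inl ⟨h, h1, h2⟩
  · rfl

lemma left_mem_flipEntry (h : c.2 < n ∧ T.Free k c.1 c.2) :
    k ∈ T.flipEntry k n c ↔ k + 1 ∈ T.entry (c.1, mirror (T.Free k c.1) n c.2) := by
  rw [flipEntry, if_pos h]
  simp only [Finset.mem_union, Finset.mem_filter, Finset.mem_image]
  constructor
  · rintro (h | ⟨x, ⟨hx, rfl | rfl⟩, he⟩)
    · exact absurd rfl h.2.1
    · simp at he
    · exact hx
  · exact fun h => Or.inr ⟨k + 1, ⟨h, Or.inr rfl⟩, by simp⟩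

lemma right_mem_flipEntry (h : c.2 < n ∧ T.Free k c.1 c.2) :
    k + 1 ∈ T.flipEntry k n c ↔ k ∈ T.entry (c.1, mirror (T.Free k c.1) n c.2) := by
  rw [flipEntry, if_pos h]
  simp only [Finset.mem_union, Finset.mem_filter, Finset.mem_image]
  constructor
  · rintro (h | ⟨x, ⟨hx, rfl | rfl⟩, he⟩)
    · exact absurd rfl h.2.2
    · exact hx
    · simp at he
  · exact fun h => Or.inr ⟨k, ⟨h, Or.inl rfl⟩, by simp⟩

lemma mirror_free {i j : ℕ} (h : j < n ∧ T.Free k i j) :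
    mirror (T.Free k i) n j < n ∧ T.Free k i (mirror (T.Free k i) n j) :=
  mirror_mem (free_convex i) h.1 h.2

lemma meets_flipEntry :
    (k ∈ T.flipEntry k n c ∨ k + 1 ∈ T.flipEntry k n c) ↔ T.Meets k c := by
  by_cases h : c.2 < n ∧ T.Free k c.1 c.2
  · rw [left_mem_flipEntry h, right_mem_flipEntry h]
    have := (mirror_free h).2.1
    exact iff_of_true this.symm h.2.1
  · rw [flipEntry_of_not h]; rfl

/-- An outside letter compares with the letters `k, k + 1` of a box in the same way. -/
lemma le_of_mem_flipEntry {i j j' a b : ℕ} (hj : j < j')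
    (ha : a ∈ T.flipEntry k n (i, j)) (hb : b ∈ T.flipEntry k n (i, j'))
    (h : ¬ (a = k + 1 ∧ b = k)) : a ≤ b := by
  by_cases ha' : a = k ∨ a = k + 1
  · by_cases hb' : b = k ∨ b = k + 1
    · omega
    · push Not at hb'
      rw [mem_flipEntry_of_ne hb'.1 hb'.2] at hb
      have hm : T.Meets k (i, j) := (meets_flipEntry (n := n)).1 (by
        rcases ha' with rfl | rfl
        · exact Or.inl ha
        · exact Or.inr ha)
      rcases hm with hm | hm <;> have := row_mono hj hm hb <;> omega
  · push Not at ha'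
    rw [mem_flipEntry_of_ne ha'.1 ha'.2] at ha
    by_cases hb' : b = k ∨ b = k + 1
    · have hm : T.Meets k (i, j') := (meets_flipEntry (n := n)).1 (by
        rcases hb' with rfl | rfl
        · exact Or.inl hb
        · exact Or.inr hb)
      rcases hm with hm | hm <;> have := row_mono hj ha hm <;> omega
    · push Not at hb'
      rw [mem_flipEntry_of_ne hb'.1 hb'.2] at hb
      exact row_mono hj ha hb

/-- The Bender–Knuth reflection of `T` at `{k, k + 1}` in the columns before column `n`. -/
noncomputable def flip (T : SVT nu.cells) (k n : ℕ) (hT : ∀ i, k ∉ T.entry (i, n)) :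
    SVT nu.cells where
  entry := T.flipEntry k n
  nonempty_of_mem c hc := by
    by_cases h : T.Meets k c
    · rcases meets_flipEntry (n := n).2 h with h | h <;> exact ⟨_, h⟩
    · obtain ⟨x, hx⟩ := T.nonempty_of_mem c hc
      refine ⟨x, (mem_flipEntry_of_ne ?_ ?_).2 hx⟩
      · rintro rfl; exact h (Or.inl hx)
      · rintro rfl; exact h (Or.inr hx)
  eq_empty_of_not_mem c hc := by
    rw [flipEntry_of_not, T.eq_empty_of_not_mem c hc]
    rintro ⟨-, h, -⟩
    exact hc (h.elim T.mem_cells T.mem_cells)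
  row_weak i j _ _ a ha b hb := by
    refine le_of_mem_flipEntry (Nat.lt_succ_self j) ha hb ?_
    rintro ⟨rfl, rfl⟩
    have m1 : T.Meets b (i, j) := meets_flipEntry.1 (Or.inr ha)
    have m2 : T.Meets b (i, j + 1) := meets_flipEntry.1 (Or.inl hb)
    by_cases f1 : j < n ∧ T.Free b i j
    · by_cases f2 : j + 1 < n ∧ T.Free b i (j + 1)
      · rw [right_mem_flipEntry f1] at ha
        rw [left_mem_flipEntry f2] at hb
        have h3 := mirror_eq_succ f2.1 f2.2
        simp only at ha hb
        rw [h3] at ha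
        have := row_mono (Nat.lt_succ_self _) hb ha
        omega
      · rw [flipEntry_of_not f2] at hb
        have hlt : j + 1 < n := by
          rcases Nat.lt_or_ge (j + 1) n with h | h
          · exact h
          · obtain rfl : n = j + 1 := by omega
            exact absurd hb (hT i)
        refine f2 ⟨hlt, m2, fun h => f1.2.2.1 (meets_below_of_lt (Nat.lt_succ_self j) m1 m2 h),
          ?_⟩
        rintro i' rfl h
        exact (mem_of_meets_below h m2).2.2.1 hb
    · rw [flipEntry_of_not f1] at ha
      by_cases f2 : j + 1 < n ∧ T.Free b i (j + 1)
      · refine f1 ⟨by omega, m1, fun h => (mem_of_meets_below m1 h).2.1 ha, ?_⟩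
        rintro i' rfl h
        exact f2.2.2.2 i' rfl (meets_above_of_lt (Nat.lt_succ_self j) h m1 m2)
      · rw [flipEntry_of_not f2] at hb
        have := row_mono (Nat.lt_succ_self j) ha hb
        omega
  col_strict i j _ _ a ha b hb := by
    by_cases h : T.Meets k (i, j) ∧ T.Meets k (i + 1, j)
    · rw [flipEntry_of_not (fun f => f.2.2.1 h.2)] at ha
      rw [flipEntry_of_not (fun f => f.2.2.2 i rfl h.1)] at hb
      exact col_mono (Nat.lt_succ_self i) ha hb
    · by_cases ha' : a = k ∨ a = k + 1
      · have m1 : T.Meets k (i, j) := meets_flipEntry.1 (by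
          rcases ha' with rfl | rfl
          · exact Or.inl ha
          · exact Or.inr ha)
        have m2 : ¬ T.Meets k (i + 1, j) := fun m => h ⟨m1, m⟩
        have hb1 : b ≠ k := by rintro rfl; exact m2 (meets_flipEntry.1 (Or.inl hb))
        have hb2 : b ≠ k + 1 := by rintro rfl; exact m2 (meets_flipEntry.1 (Or.inr hb))
        rw [mem_flipEntry_of_ne hb1 hb2] at hb
        rcases m1 with m | m <;> have := col_mono (Nat.lt_succ_self i) m hb <;> omega
      · push Not at ha'
        rw [mem_flipEntry_of_ne ha'.1 ha'.2] at ha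
        by_cases hb' : b = k ∨ b = k + 1
        · have m1 : T.Meets k (i + 1, j) := meets_flipEntry.1 (by
            rcases hb' with rfl | rfl
            · exact Or.inl hb
            · exact Or.inr hb)
          rcases m1 with m | m <;> have := col_mono (Nat.lt_succ_self i) ha m <;> omega
        · push Not at hb'
          rw [mem_flipEntry_of_ne hb'.1 hb'.2] at hb
          exact col_mono (Nat.lt_succ_self i) ha hb

variable {hT : ∀ i, k ∉ T.entry (i, n)}

lemma flip_entry_of_ge (h : n ≤ c.2) : (T.flip k n hT).entry c = T.entry c :=
  flipEntry_of_not (by omega)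

lemma not_mem_flip (i : ℕ) : k ∉ (T.flip k n hT).entry (i, n) := by
  rw [flip_entry_of_ge (c := (i, n)) le_rfl]; exact hT i

lemma free_flip {i j : ℕ} : (T.flip k n hT).Free k i j ↔ T.Free k i j := by
  have h : ∀ c, (T.flip k n hT).Meets k c ↔ T.Meets k c := fun c => meets_flipEntry
  simp only [Free, h]

lemma flip_flip (hT' : ∀ i, k ∉ (T.flip k n hT).entry (i, n)) :
    (T.flip k n hT).flip k n hT' = T := by
  refine ext_entry fun c => ?_
  change (T.flip k n hT).flipEntry k n c = T.entry c
  have hP : ∀ i, (T.flip k n hT).Free k i = T.Free k i :=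
    fun i => funext fun j => propext free_flip
  by_cases h : c.2 < n ∧ T.Free k c.1 c.2
  · have h' : c.2 < n ∧ (T.flip k n hT).Free k c.1 c.2 := ⟨h.1, free_flip.2 h.2⟩
    have hm := mirror_free h
    have hmm := mirror_mirror h.1 h.2
    ext e
    rcases eq_or_ne e k with rfl | h1
    · rw [left_mem_flipEntry h', hP]
      change e + 1 ∈ T.flipEntry e n _ ↔ _
      rw [right_mem_flipEntry hm, hmm]
    · rcases eq_or_ne e (k + 1) with rfl | h2
      · rw [right_mem_flipEntry h', hP]
        change k ∈ T.flipEntry k n _ ↔ _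
        rw [left_mem_flipEntry hm, hmm]
      · rw [mem_flipEntry_of_ne h1 h2]
        exact mem_flipEntry_of_ne h1 h2
  · rw [flipEntry_of_not (fun f => h ⟨f.1, free_flip.1 f.2⟩)]
    exact flipEntry_of_not h

/-- Reflecting the rows preserves the absence of boxes containing both `k` and `k + 1`. -/
lemma flip_not_both {i m : ℕ} (hn : n ≤ m)
    (h : ∀ j ≤ m, ¬ (k ∈ T.entry (i, j) ∧ k + 1 ∈ T.entry (i, j))) (j : ℕ) (hj : j ≤ m) :
    ¬ (k ∈ (T.flip k n hT).entry (i, j) ∧ k + 1 ∈ (T.flip k n hT).entry (i, j)) := by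
  change ¬ (k ∈ T.flipEntry k n (i, j) ∧ k + 1 ∈ T.flipEntry k n (i, j))
  by_cases hf : j < n ∧ T.Free k i j
  · rw [left_mem_flipEntry hf, right_mem_flipEntry hf]
    have := h _ ((mirror_free hf).1.le.trans hn)
    tauto
  · rw [flipEntry_of_not hf]
    exact h j hj

open Classical in
/-- Below column `n`, the reflection exchanges the numbers of `k` and `k + 1`. -/
lemma card_flip_left :
    (nu.cells.filter fun c => c.2 < n ∧ k ∈ (T.flip k n hT).entry c).card =
      (nu.cells.filter fun c => c.2 < n ∧ k + 1 ∈ T.entry c).card := by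
  refine Finset.card_nbij' (fun c => if T.Free k c.1 c.2 then (c.1, mirror (T.Free k c.1) n c.2)
    else (c.1 + 1, c.2)) (fun c => if T.Free k c.1 c.2 then (c.1, mirror (T.Free k c.1) n c.2)
    else (c.1 - 1, c.2)) ?_ ?_ ?_ ?_
  · rintro ⟨i, j⟩ hc
    simp only [Finset.coe_filter, Set.mem_ofPred_eq] at hc ⊢
    obtain ⟨-, hj, hk⟩ := hc
    change k ∈ T.flipEntry k n (i, j) at hk
    split_ifs with hf
    · rw [left_mem_flipEntry ⟨hj, hf⟩] at hk
      exact ⟨T.mem_cells hk, (mirror_free ⟨hj, hf⟩).1, hk⟩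
    · rw [flipEntry_of_not (fun f => hf f.2)] at hk
      have hb : T.Meets k (i + 1, j) := by
        by_contra hb
        refine hf ⟨Or.inl hk, hb, ?_⟩
        rintro i' rfl h
        exact (mem_of_meets_below h (Or.inl hk)).2.2.1 hk
      have := (mem_of_meets_below (Or.inl hk) hb).2.2.2
      exact ⟨T.mem_cells this, hj, this⟩
  · rintro ⟨i, j⟩ hc
    simp only [Finset.coe_filter, Set.mem_ofPred_eq] at hc ⊢
    obtain ⟨-, hj, hk⟩ := hc
    split_ifs with hf
    · obtain ⟨m1, m2⟩ := mirror_free ⟨hj, hf⟩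
      have : k ∈ T.flipEntry k n (i, mirror (T.Free k i) n j) := by
        rw [left_mem_flipEntry ⟨m1, m2⟩, mirror_mirror hj hf]; exact hk
      exact ⟨(T.flip k n hT).mem_cells this, m1, this⟩
    · have : ∃ i', i' + 1 = i ∧ T.Meets k (i', j) := by
        by_contra hb
        push Not at hb
        exact hf ⟨Or.inr hk, fun h => (mem_of_meets_below (Or.inr hk) h).2.1 hk, hb⟩
      obtain ⟨i', rfl, hm⟩ := this
      have hk' := (mem_of_meets_below hm (Or.inr hk)).1
      have : k ∈ T.flipEntry k n (i', j) := by
        rwa [flipEntry_of_not (fun f => f.2.2.1 (Or.inr hk))]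
      exact ⟨T.mem_cells hk', hj, this⟩
  · rintro ⟨i, j⟩ hc
    simp only [Finset.coe_filter, Set.mem_ofPred_eq] at hc
    obtain ⟨-, hj, hk⟩ := hc
    change k ∈ T.flipEntry k n (i, j) at hk
    by_cases hf : T.Free k i j
    · simp only [hf, if_true, (mirror_free ⟨hj, hf⟩).2, mirror_mirror hj hf]
    · have : ¬ T.Free k (i + 1) j := by
        rw [flipEntry_of_not (fun f => hf f.2)] at hk
        exact fun h => h.2.2 i rfl (Or.inl hk)
      simp [hf, this]
  · rintro ⟨i, j⟩ hc
    simp only [Finset.coe_filter, Set.mem_ofPred_eq] at hc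
    obtain ⟨-, hj, hk⟩ := hc
    by_cases hf : T.Free k i j
    · simp only [hf, if_true, (mirror_free ⟨hj, hf⟩).2, mirror_mirror hj hf]
    · have : ∃ i', i' + 1 = i ∧ T.Meets k (i', j) := by
        by_contra hb
        push Not at hb
        exact hf ⟨Or.inr hk, fun h => (mem_of_meets_below (Or.inr hk) h).2.1 hk, hb⟩
      obtain ⟨i', rfl, hm⟩ := this
      have : ¬ T.Free k i' j := fun h => h.2.1 (Or.inr hk)
      simp [hf, this]

end SVT

namespace SVT

section Weight

variable {cells : Finset (ℕ × ℕ)}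

lemma finite_setOf_bounded (cells : Finset (ℕ × ℕ)) (m : ℕ) :
    {T : SVT cells | T.Bounded m}.Finite := by
  refine Set.Finite.of_finite_image (f := fun T (c : cells) => T.entry c)
    ((Set.Finite.pi' fun _ : cells => (Finset.range m).powerset.finite_toSet).subset ?_) ?_
  · rintro _ ⟨T, hT, rfl⟩ c
    simp only [Finset.coe_powerset, Set.mem_preimage, Set.mem_powerset_iff, Finset.coe_subset]
    exact fun x hx => Finset.mem_range.2 (hT c x hx)
  · intro T _ T' _ h
    refine ext_entry fun c => ?_
    by_cases hc : c ∈ cells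
    · exact congrFun h ⟨c, hc⟩
    · rw [T.eq_empty_of_not_mem c hc, T'.eq_empty_of_not_mem c hc]

/-- The set-valued tableaux with entries below `m`. -/
noncomputable def boundedSVT (cells : Finset (ℕ × ℕ)) (m : ℕ) : Finset (SVT cells) :=
  (finite_setOf_bounded cells m).toFinset

@[simp] lemma mem_boundedSVT {m : ℕ} {T : SVT cells} :
    T ∈ boundedSVT cells m ↔ T.Bounded m := by
  simp [boundedSVT]

/-- The signed monomial of a set-valued tableau. -/
noncomputable def weight (T : SVT cells) : MvPolynomial ℕ ℤ :=
  ((-1 : ℤ) ^ (T.size - cells.card)) • T.monomial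

lemma grothendieck_eq_sum (cells : Finset (ℕ × ℕ)) (m : ℕ) :
    grothendieck cells m = ∑ T ∈ boundedSVT cells m, T.weight :=
  finsum_mem_eq_finite_toFinset_sum _ (finite_setOf_bounded cells m)

/-- The number of boxes in columns `≥ j` that contain `t`. -/
def countFrom (T : SVT cells) (t j : ℕ) : ℕ :=
  (cells.filter fun c => j ≤ c.2 ∧ t ∈ T.entry c).card

variable {T T' : SVT cells} {m k : ℕ}

lemma countFrom_congr {t j : ℕ} (h : ∀ c, j ≤ c.2 → T.entry c = T'.entry c) :
    T.countFrom t j = T'.countFrom t j := by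
  rw [countFrom, countFrom]
  congr 1
  refine Finset.filter_congr fun c _ => and_congr_right fun hc => by rw [h c hc]

lemma countFrom_zero (T : SVT cells) (t : ℕ) :
    T.countFrom t 0 = (cells.filter fun c => t ∈ T.entry c).card := by
  simp [countFrom]

lemma countFrom_zero_eq_add (T : SVT cells) (t n : ℕ) :
    T.countFrom t 0 = (cells.filter fun c => c.2 < n ∧ t ∈ T.entry c).card +
      T.countFrom t n := by
  rw [countFrom_zero, countFrom, ← Finset.card_union_of_disjoint]
  · congr 1
    ext c
    simp only [Finset.mem_filter, Finset.mem_union]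
    have := Nat.lt_or_ge c.2 n
    tauto
  · rw [Finset.disjoint_filter]
    intro c _ h h'
    omega

lemma Bounded.size_eq (hT : T.Bounded m) :
    T.size = ∑ t ∈ Finset.range m, T.countFrom t 0 := by
  simp only [countFrom_zero, Finset.card_filter]
  rw [Finset.sum_comm, size]
  refine Finset.sum_congr rfl fun c _ => ?_
  rw [← Finset.card_filter]
  congr 1
  ext x
  simp only [Finset.mem_filter, Finset.mem_range]
  exact ⟨fun h => ⟨hT c x h, h⟩, fun h => h.2⟩

lemma Bounded.monomial_eq (hT : T.Bounded m) :
    T.monomial = ∏ t ∈ Finset.range m, X t ^ T.countFrom t 0 := by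
  simp only [countFrom_zero, ← Finset.prod_const, Finset.prod_filter]
  rw [Finset.prod_comm, SVT.monomial]
  refine Finset.prod_congr rfl fun c _ => ?_
  rw [← Finset.prod_filter]
  refine Finset.prod_congr ?_ fun _ _ => rfl
  ext x
  simp only [Finset.mem_filter, Finset.mem_range]
  exact ⟨fun h => ⟨hT c x h, h⟩, fun h => h.2⟩

lemma card_le_size (T : SVT cells) : cells.card ≤ T.size := by
  rw [Finset.card_eq_sum_ones]
  exact Finset.sum_le_sum fun c hc => (T.nonempty_of_mem c hc).card_pos

lemma rename_swap_weight (hk : k + 1 < m) (hT : T.Bounded m) (hT' : T'.Bounded m) (δ : ℕ)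
    (h : ∀ t, T'.countFrom t 0 + (if t = k then δ else 0) =
      T.countFrom (Equiv.swap k (k + 1) t) 0 +
        (if Equiv.swap k (k + 1) t = k then δ else 0)) :
    rename (Equiv.swap k (k + 1)) (X k ^ δ * T.weight) = X k ^ δ * T'.weight := by
  have hkm : k ∈ Finset.range m := Finset.mem_range.2 (by omega)
  have e : ∀ S : SVT cells, S.Bounded m → X k ^ δ * S.monomial =
      ∏ t ∈ Finset.range m, X t ^ (S.countFrom t 0 + (if t = k then δ else 0)) := by
    intro S hS
    simp only [pow_add, Finset.prod_mul_distrib, hS.monomial_eq, pow_ite, pow_zero]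
    rw [Finset.prod_ite_eq', if_pos hkm, mul_comm]
  have hsize : T'.size = T.size := by
    have hs : ∀ S : SVT cells, S.Bounded m → S.size + δ =
        ∑ t ∈ Finset.range m, (S.countFrom t 0 + (if t = k then δ else 0)) := by
      intro S hS
      rw [Finset.sum_add_distrib, hS.size_eq, Finset.sum_ite_eq', if_pos hkm]
    have : T'.size + δ = T.size + δ := by
      rw [hs T' hT', hs T hT]
      have := prod_range_swap hk fun t => Multiplicative.ofAdd
        (T.countFrom t 0 + (if t = k then δ else 0))
      rw [← ofAdd_sum, ← ofAdd_sum] at this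
      rw [← Multiplicative.ofAdd.injective this]
      exact Finset.sum_congr rfl fun t _ => h t
    omega
  rw [weight, weight, mul_smul_comm, mul_smul_comm, map_zsmul, e T hT, e T' hT', hsize, map_prod]
  congr 1
  simp only [map_pow, rename_X]
  rw [← prod_range_swap hk]
  refine Finset.prod_congr rfl fun t _ => ?_
  rw [Equiv.swap_apply_self, h t]

end Weight

variable {nu : YoungDiagram} {T T' : SVT nu.cells} {k n m i j t : ℕ}

lemma countFrom_of_mem (h : t ∈ T.entry (i, j)) :
    T.countFrom t j = T.countFrom t (j + 1) + 1 := by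
  rw [countFrom, countFrom, ← Finset.card_insert_of_notMem (a := (i, j)) (by simp)]
  congr 1
  ext ⟨a, b⟩
  simp only [Finset.mem_filter, Finset.mem_insert, Prod.mk.injEq]
  constructor
  · rintro ⟨h1, h2, h3⟩
    rcases eq_or_ne b j with rfl | hb
    · exact Or.inl ⟨row_unique h3 h, rfl⟩
    · exact Or.inr ⟨h1, by omega, h3⟩
  · rintro (⟨rfl, rfl⟩ | ⟨h1, h2, h3⟩)
    · exact ⟨T.mem_cells h, le_rfl, h⟩
    · exact ⟨h1, by omega, h3⟩

lemma countFrom_succ_le (T : SVT nu.cells) (t j : ℕ) :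
    T.countFrom t (j + 1) ≤ T.countFrom t j := by
  refine Finset.card_le_card fun c hc => ?_
  simp only [Finset.mem_filter] at hc ⊢
  exact ⟨hc.1, by omega, hc.2.2⟩

lemma countFrom_of_forall_not_mem (h : ∀ i, t ∉ T.entry (i, j)) :
    T.countFrom t j = T.countFrom t (j + 1) := by
  rw [countFrom, countFrom]
  congr 1
  ext ⟨a, b⟩
  simp only [Finset.mem_filter]
  constructor
  · rintro ⟨h1, h2, h3⟩
    rcases eq_or_ne b j with rfl | hb
    · exact absurd h3 (h a)
    · exact ⟨h1, by omega, h3⟩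
  · rintro ⟨h1, h2, h3⟩
    exact ⟨h1, by omega, h3⟩

/-- The letter `t + 1` of the box `(i, j)` breaks the reverse lattice condition: when it is
read, from the right, the letters `t` and `t + 1` were tied (or it was broken before). -/
def Violates (T : SVT nu.cells) (t i j : ℕ) : Prop :=
  t + 1 ∈ T.entry (i, j) ∧ (∀ i' < i, t ∉ T.entry (i', j)) ∧
    T.countFrom t (j + 1) ≤ T.countFrom (t + 1) (j + 1)

lemma violates_congr (h : ∀ c : ℕ × ℕ, j < c.2 → T.entry c = T'.entry c)
    (h1 : t + 1 ∈ T.entry (i, j) ↔ t + 1 ∈ T'.entry (i, j))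
    (h2 : ∀ i' < i, (t ∈ T.entry (i', j) ↔ t ∈ T'.entry (i', j))) :
    T.Violates t i j ↔ T'.Violates t i j := by
  rw [Violates, Violates, h1, countFrom_congr (T := T) (T' := T') (t := t) (fun c hc => h c hc),
    countFrom_congr (T := T) (T' := T') (t := t + 1) (fun c hc => h c hc)]
  refine and_congr_right fun _ => and_congr_left fun _ => forall₂_congr fun i' hi' => ?_
  rw [h2 i' hi']

lemma countFrom_succ_le_of_forall_not_violates
    (h : ∀ i j', j ≤ j' → ¬ T.Violates t i j') : T.countFrom (t + 1) j ≤ T.countFrom t j := by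
  obtain ⟨M, hM⟩ : ∃ M, ∀ c ∈ nu.cells, c.2 < M :=
    ⟨nu.cells.sup Prod.snd + 1, fun c hc => Nat.lt_succ_of_le (Finset.le_sup (f := Prod.snd) hc)⟩
  obtain ⟨d, hd⟩ : ∃ d, M ≤ j + d := ⟨M, by omega⟩
  induction d generalizing j with
  | zero =>
    rw [countFrom, Finset.card_eq_zero.2]
    · exact Nat.zero_le _
    · refine Finset.filter_eq_empty_iff.2 fun c hc hc' => ?_
      have := hM c hc
      omega
  | succ d ih =>
    have ih' := ih (j := j + 1) (fun i j' hj => h i j' (by omega)) (by omega)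
    by_cases h1 : ∃ i, t + 1 ∈ T.entry (i, j)
    · obtain ⟨i, hi⟩ := h1
      rw [countFrom_of_mem hi]
      by_cases h2 : ∃ i' < i, t ∈ T.entry (i', j)
      · obtain ⟨i', -, hi'⟩ := h2
        rw [countFrom_of_mem hi']
        omega
      · have h3 := h i j le_rfl
        have h4 := T.countFrom_succ_le t j
        push Not at h2
        by_contra hcon
        exact h3 ⟨hi, h2, by omega⟩
    · push Not at h1
      rw [countFrom_of_forall_not_mem h1]
      exact ih'.trans (T.countFrom_succ_le t j)

/-! ### The symmetry of Grothendieck polynomials -/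

section Flip

variable {hT : ∀ i, k ∉ T.entry (i, n)}

lemma Bounded.flip (h : T.Bounded m) (hk : k + 1 < m) : (T.flip k n hT).Bounded m := by
  intro c x hx
  rcases eq_or_ne x k with rfl | h1
  · omega
  · rcases eq_or_ne x (k + 1) with rfl | h2
    · omega
    · exact h c x ((mem_flipEntry_of_ne h1 h2).1 hx)

lemma card_flip_right :
    (nu.cells.filter fun c => c.2 < n ∧ k + 1 ∈ (T.flip k n hT).entry c).card =
      (nu.cells.filter fun c => c.2 < n ∧ k ∈ T.entry c).card := by
  conv_rhs => rw [← flip_flip (T := T) (hT := hT) not_mem_flip]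
  exact card_flip_left.symm

lemma countFrom_flip (t : ℕ) :
    (T.flip k n hT).countFrom t 0 =
      (nu.cells.filter fun c => c.2 < n ∧ Equiv.swap k (k + 1) t ∈ T.entry c).card +
        T.countFrom t n := by
  rw [countFrom_zero_eq_add _ t n, countFrom_congr (T := T.flip k n hT) (T' := T)
    (fun c hc => flip_entry_of_ge hc)]
  congr 1
  rcases eq_or_ne t k with rfl | h1
  · rw [Equiv.swap_apply_left, card_flip_left]
  · rcases eq_or_ne t (k + 1) with rfl | h2
    · rw [Equiv.swap_apply_right, card_flip_right]
    · rw [Equiv.swap_apply_of_ne_of_ne h1 h2]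
      congr 1
      refine Finset.filter_congr fun c _ => and_congr_right fun _ => ?_
      exact mem_flipEntry_of_ne h1 h2

end Flip

end SVT

open SVT in
/-- Grothendieck polynomials are symmetric. -/
theorem rename_swap_grothendieck (nu : YoungDiagram) {m k : ℕ} (hk : k + 1 < m) :
    rename (Equiv.swap k (k + 1)) (grothendieck nu.cells m) = grothendieck nu.cells m := by
  set n := nu.cells.sup Prod.snd + 1 with hn
  have hout : ∀ c ∈ nu.cells, c.2 < n := fun c hc =>
    Nat.lt_succ_of_le (Finset.le_sup (f := Prod.snd) hc)
  have hT : ∀ (T : SVT nu.cells) i, k ∉ T.entry (i, n) := fun T i h =>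
    absurd (hout _ (T.mem_cells h)) (lt_irrefl _)
  have h0 : ∀ (T : SVT nu.cells) t, T.countFrom t n = 0 := by
    intro T t
    refine Finset.card_eq_zero.2 (Finset.filter_eq_empty_iff.2 fun c hc hc' => ?_)
    have := hout c hc
    omega
  rw [grothendieck_eq_sum, map_sum]
  refine Finset.sum_nbij' (fun T => T.flip k n (hT T)) (fun T => T.flip k n (hT T)) ?_ ?_ ?_ ?_ ?_
  · exact fun T h => mem_boundedSVT.2 ((mem_boundedSVT.1 h).flip hk)
  · exact fun T h => mem_boundedSVT.2 ((mem_boundedSVT.1 h).flip hk)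
  · exact fun T _ => flip_flip _
  · exact fun T _ => flip_flip _
  · intro T h
    rw [mem_boundedSVT] at h
    have := rename_swap_weight hk h (h.flip (hT := hT T) hk) 0 (fun t => by
      rw [countFrom_flip, countFrom_zero_eq_add _ _ n, h0, h0]; simp)
    simpa using this

namespace SVT

variable {nu : YoungDiagram} {T T' : SVT nu.cells} {k n m i j t : ℕ} {K : Set ℕ}

/-! ### Toggling the letter `k` in the first box of a row containing `k + 1` -/

/-- The first column in which row `i` contains `k + 1`. -/
noncomputable def firstCol (T : SVT nu.cells) (k i : ℕ) : ℕ :=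
  sInf {u | k + 1 ∈ T.entry (i, u)}

lemma firstCol_mem (h : k + 1 ∈ T.entry (i, j)) : k + 1 ∈ T.entry (i, T.firstCol k i) :=
  Nat.sInf_mem (s := {u | k + 1 ∈ T.entry (i, u)}) ⟨j, h⟩

lemma firstCol_le (h : k + 1 ∈ T.entry (i, j)) : T.firstCol k i ≤ j :=
  Nat.sInf_le h

lemma not_mem_of_lt_firstCol {u : ℕ} (h : u < T.firstCol k i) : k + 1 ∉ T.entry (i, u) :=
  Nat.notMem_of_lt_sInf (s := {u | k + 1 ∈ T.entry (i, u)}) h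

lemma not_mem_above_firstCol (h : k + 1 ∈ T.entry (i, j)) (h' : ∀ i' < i, k ∉ T.entry (i', j))
    {i' : ℕ} (hi : i' < i) : k ∉ T.entry (i', T.firstCol k i) := by
  intro hk
  rcases (firstCol_le h).eq_or_lt with he | hlt
  · rw [he] at hk
    exact h' i' hi hk
  · have hc : (i', j) ∈ nu.cells :=
      nu.isLowerSet (by simp [hi.le] : ((i', j) : ℕ × ℕ) ≤ (i, j)) (T.mem_cells h)
    obtain ⟨x, hx⟩ := T.nonempty_of_mem _ hc
    have h1 := row_mono hlt hk hx
    have h2 := col_mono hi hx h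
    obtain rfl : x = k := by omega
    exact h' i' hi hx

/-- Entries after toggling `k` in the first box of row `i` containing `k + 1`. -/
noncomputable def toggleEntry (T : SVT nu.cells) (k i : ℕ) (c : ℕ × ℕ) : Finset ℕ :=
  if c = (i, T.firstCol k i) then symmDiff (T.entry c) {k} else T.entry c

lemma mem_toggleEntry {c : ℕ × ℕ} {a : ℕ} (h : ¬ (a = k ∧ c = (i, T.firstCol k i))) :
    a ∈ T.toggleEntry k i c ↔ a ∈ T.entry c := by
  rw [toggleEntry]
  split_ifs with hc
  · have : a ≠ k := fun e => h ⟨e, hc⟩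
    simp [Finset.mem_symmDiff, this]
  · rfl

lemma mem_toggleEntry_self :
    k ∈ T.toggleEntry k i (i, T.firstCol k i) ↔ k ∉ T.entry (i, T.firstCol k i) := by
  simp [toggleEntry, Finset.mem_symmDiff]

/-- Toggling `k` in the first box of row `i` containing `k + 1`. -/
noncomputable def toggle (T : SVT nu.cells) (k i j : ℕ) (h : k + 1 ∈ T.entry (i, j))
    (h' : ∀ i' < i, k ∉ T.entry (i', j)) : SVT nu.cells where
  entry := T.toggleEntry k i
  nonempty_of_mem c hc := by
    by_cases hc' : c = (i, T.firstCol k i)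
    · subst hc'
      exact ⟨k + 1, (mem_toggleEntry (by simp)).2 (firstCol_mem h)⟩
    · rw [toggleEntry, if_neg hc']
      exact T.nonempty_of_mem c hc
  eq_empty_of_not_mem c hc := by
    have hc' : c ≠ (i, T.firstCol k i) := by
      rintro rfl
      exact hc (T.mem_cells (firstCol_mem h))
    rw [toggleEntry, if_neg hc', T.eq_empty_of_not_mem c hc]
  row_weak r u _ _ a ha b hb := by
    by_cases h1 : a = k ∧ (r, u) = (i, T.firstCol k i)
    · obtain ⟨rfl, he⟩ := h1
      obtain ⟨rfl, rfl⟩ := Prod.mk.injEq .. ▸ he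
      rw [mem_toggleEntry (by simp)] at hb
      have := row_mono (Nat.lt_succ_self _) (firstCol_mem h) hb
      omega
    · rw [mem_toggleEntry h1] at ha
      by_cases h2 : b = k ∧ (r, u + 1) = (i, T.firstCol k i)
      · obtain ⟨rfl, he⟩ := h2
        obtain ⟨rfl, he⟩ := Prod.mk.injEq .. ▸ he
        have hf := firstCol_mem h
        rw [← he] at hf
        have h3 := row_mono (Nat.lt_succ_self u) ha hf
        have h4 : a ≠ b + 1 := by
          rintro rfl
          exact not_mem_of_lt_firstCol (by omega) ha
        omega
      · rw [mem_toggleEntry h2] at hb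
        exact row_mono (Nat.lt_succ_self u) ha hb
  col_strict r u _ _ a ha b hb := by
    by_cases h1 : a = k ∧ (r, u) = (i, T.firstCol k i)
    · obtain ⟨rfl, he⟩ := h1
      obtain ⟨rfl, rfl⟩ := Prod.mk.injEq .. ▸ he
      rw [mem_toggleEntry (by simp)] at hb
      have := col_mono (Nat.lt_succ_self _) (firstCol_mem h) hb
      omega
    · rw [mem_toggleEntry h1] at ha
      by_cases h2 : b = k ∧ (r + 1, u) = (i, T.firstCol k i)
      · obtain ⟨rfl, he⟩ := h2
        obtain ⟨rfl, rfl⟩ := Prod.mk.injEq .. ▸ he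
        have h3 := col_mono (Nat.lt_succ_self r) ha (firstCol_mem h)
        have h4 : a ≠ b := by
          rintro rfl
          exact not_mem_above_firstCol h h' (by omega) ha
        omega
      · rw [mem_toggleEntry h2] at hb
        exact col_mono (Nat.lt_succ_self r) ha hb

section Toggle

variable {h : k + 1 ∈ T.entry (i, j)} {h' : ∀ i' < i, k ∉ T.entry (i', j)}

lemma mem_toggle {c : ℕ × ℕ} {a : ℕ} (hc : ¬ (a = k ∧ c = (i, T.firstCol k i))) :
    a ∈ (T.toggle k i j h h').entry c ↔ a ∈ T.entry c :=
  mem_toggleEntry hc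

lemma firstCol_toggle : (T.toggle k i j h h').firstCol k i = T.firstCol k i := by
  have : ∀ u, k + 1 ∈ (T.toggle k i j h h').entry (i, u) ↔ k + 1 ∈ T.entry (i, u) :=
    fun u => mem_toggle (by simp)
  simp only [firstCol, this]

lemma toggle_toggle (g : k + 1 ∈ (T.toggle k i j h h').entry (i, j))
    (g' : ∀ i' < i, k ∉ (T.toggle k i j h h').entry (i', j)) :
    (T.toggle k i j h h').toggle k i j g g' = T := by
  refine ext_entry fun c => ?_
  change (T.toggle k i j h h').toggleEntry k i c = T.entry c
  rw [toggleEntry, firstCol_toggle]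
  change (if _ then symmDiff (T.toggleEntry k i c) {k} else T.toggleEntry k i c) = _
  rw [toggleEntry]
  split_ifs
  · exact symmDiff_symmDiff_cancel_right _ _
  · rfl

lemma toggle_entry_of_lt {c : ℕ × ℕ} (hc : j < c.2) :
    (T.toggle k i j h h').entry c = T.entry c := by
  refine if_neg ?_
  rintro rfl
  exact absurd (firstCol_le h) (by simpa using hc)

lemma toggle_mem_above {i' u : ℕ} (hi : i' < i) :
    k ∈ (T.toggle k i j h h').entry (i', u) ↔ k ∈ T.entry (i', u) := by
  refine mem_toggle ?_
  rintro ⟨-, he⟩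
  have := (Prod.mk.injEq .. ▸ he).1
  omega

lemma Bounded.toggle (hT : T.Bounded m) (hk : k < m) : (T.toggle k i j h h').Bounded m := by
  intro c x hx
  rcases eq_or_ne x k with rfl | h1
  · exact hk
  · exact hT c x ((mem_toggle (by tauto)).1 hx)

lemma countFrom_toggle (hk : k ∉ T.entry (i, T.firstCol k i)) (t : ℕ) :
    (T.toggle k i j h h').countFrom t 0 = T.countFrom t 0 + if t = k then 1 else 0 := by
  rw [countFrom_zero, countFrom_zero]
  split_ifs with ht
  · subst ht
    rw [← Finset.card_insert_of_notMem (a := (i, T.firstCol t i)) (by simp [hk])]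
    congr 1
    ext c
    simp only [Finset.mem_filter, Finset.mem_insert]
    by_cases hc : c = (i, T.firstCol t i)
    · subst hc
      simp only [true_or, iff_true]
      exact ⟨T.mem_cells (firstCol_mem h), mem_toggleEntry_self.2 hk⟩
    · rw [mem_toggle (by tauto)]
      tauto
  · rw [add_zero]
    congr 1
    refine Finset.filter_congr fun c _ => mem_toggle (by tauto)

lemma weight_toggle (hT : T.Bounded m) (hkm : k < m)
    (hk : k ∉ T.entry (i, T.firstCol k i)) :
    (T.toggle k i j h h').weight = - X k * T.weight := by
  have hT' := hT.toggle (h := h) (h' := h') hkm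
  have hkm' := Finset.mem_range.2 hkm
  have hs : (T.toggle k i j h h').size = T.size + 1 := by
    rw [hT'.size_eq, hT.size_eq]
    simp only [countFrom_toggle hk]
    rw [Finset.sum_add_distrib, Finset.sum_ite_eq', if_pos hkm']
  have hm : (T.toggle k i j h h').monomial = X k * T.monomial := by
    rw [hT'.monomial_eq, hT.monomial_eq]
    simp only [countFrom_toggle hk, pow_add, Finset.prod_mul_distrib, pow_ite, pow_zero, pow_one]
    rw [Finset.prod_ite_eq', if_pos hkm', mul_comm]
  have hc := T.card_le_size
  rw [weight, weight, hs, hm, show T.size + 1 - nu.cells.card = T.size - nu.cells.card + 1 by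
    omega, pow_succ, mul_smul_comm]
  simp

end Toggle

/-! ### Cancellation of the tableaux violating the lattice condition -/

/-- The first violation in the reading order (up to the order inside a column), among the letters
in `K`, is the one of `k + 1` in box `(i, j)`. -/
def IsFirstViolation (K : Set ℕ) (k i j : ℕ) (T : SVT nu.cells) : Prop :=
  k ∈ K ∧ T.Violates k i j ∧ (∀ t ∈ K, ∀ i' j', j < j' → ¬ T.Violates t i' j') ∧
    ∀ t ∈ K, k < t → ∀ i', ¬ T.Violates t i' j

lemma IsFirstViolation.unique {k' i' j' : ℕ} (h : IsFirstViolation K k i j T)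
    (h' : IsFirstViolation K k' i' j' T) : k = k' ∧ i = i' ∧ j = j' := by
  obtain ⟨a1, a2, a3, a4⟩ := h
  obtain ⟨b1, b2, b3, b4⟩ := h'
  obtain rfl : j = j' := by
    rcases lt_trichotomy j j' with h | h | h
    · exact absurd b2 (a3 _ b1 _ _ h)
    · exact h
    · exact absurd a2 (b3 _ a1 _ _ h)
  obtain rfl : k = k' := by
    rcases lt_trichotomy k k' with h | h | h
    · exact absurd b2 (a4 _ b1 h _)
    · exact h
    · exact absurd a2 (b4 _ a1 h _)
  exact ⟨rfl, row_unique a2.1 b2.1, rfl⟩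

lemma exists_isFirstViolation (hK : ∀ k ∈ K, k + 1 < m)
    (h : ∃ t ∈ K, ∃ i j, T.Violates t i j) : ∃ k i j, IsFirstViolation K k i j T := by
  have hbdd : BddAbove {j | ∃ t ∈ K, ∃ i, T.Violates t i j} := by
    refine ⟨nu.cells.sup Prod.snd, ?_⟩
    rintro j ⟨t, -, i, hv⟩
    exact Finset.le_sup (f := Prod.snd) (T.mem_cells hv.1)
  obtain ⟨t, ht, i, j, hv⟩ := h
  have hj := Nat.sSup_mem (s := {j | ∃ t ∈ K, ∃ i, T.Violates t i j}) ⟨j, t, ht, i, hv⟩ hbdd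
  set J := sSup {j | ∃ t ∈ K, ∃ i, T.Violates t i j}
  have hbdd' : BddAbove {t | t ∈ K ∧ ∃ i, T.Violates t i J} :=
    ⟨m, fun t ht => (Nat.le_succ t).trans (hK t ht.1).le⟩
  obtain ⟨hk, i, hv'⟩ := Nat.sSup_mem (s := {t | t ∈ K ∧ ∃ i, T.Violates t i J}) hj hbdd'
  refine ⟨_, i, J, hk, hv', fun t ht i' j' hlt hv'' => ?_, fun t ht hlt i' hv'' => ?_⟩
  · exact absurd (le_csSup hbdd ⟨t, ht, i', hv''⟩) (by omega)
  · exact absurd (le_csSup hbdd' ⟨ht, i', hv''⟩) (by omega)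

lemma IsFirstViolation.not_mem_column (h : IsFirstViolation K k i j T)
    (hb : ∀ j' ≤ j, ¬ (k ∈ T.entry (i, j') ∧ k + 1 ∈ T.entry (i, j'))) (i' : ℕ) :
    k ∉ T.entry (i', j) := by
  obtain ⟨-, ⟨h1, h2, -⟩, -⟩ := h
  rcases lt_trichotomy i' i with hlt | rfl | hlt
  · exact h2 i' hlt
  · exact fun hk => hb j le_rfl ⟨hk, h1⟩
  · intro hk
    have := col_mono hlt h1 hk
    omega

lemma IsFirstViolation.congr (h : IsFirstViolation K k i j T)
    (hlt : ∀ c : ℕ × ℕ, j < c.2 → T.entry c = T'.entry c)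
    (heq : ∀ i' t, t ≠ k → (t ∈ T.entry (i', j) ↔ t ∈ T'.entry (i', j)))
    (heq' : ∀ i' < i, (k ∈ T.entry (i', j) ↔ k ∈ T'.entry (i', j))) :
    IsFirstViolation K k i j T' := by
  obtain ⟨h1, h2, h3, h4⟩ := h
  refine ⟨h1, (violates_congr hlt (heq _ _ (by omega)) heq').1 h2, fun t ht i' j' hj' => ?_,
    fun t ht hkt i' => ?_⟩
  · rw [← violates_congr (T := T) (fun c hc => hlt c (hj'.trans hc)) (by rw [hlt _ hj'])
      (fun r _ => by rw [hlt (r, j') hj'])]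
    exact h3 t ht i' j' hj'
  · rw [← violates_congr (T := T) hlt (heq _ _ (by omega)) fun r _ => heq _ _ (by omega)]
    exact h4 t ht hkt i'

lemma IsFirstViolation.flip (h : IsFirstViolation K k i j T) {hT : ∀ i, k ∉ T.entry (i, j)} :
    IsFirstViolation K k i j (T.flip k j hT) := by
  refine h.congr (fun c hc => (flip_entry_of_ge hc.le).symm) (fun i' t _ => ?_) fun i' _ => ?_
  · rw [flip_entry_of_ge (c := (i', j)) le_rfl]
  · rw [flip_entry_of_ge (c := (i', j)) le_rfl]

lemma IsFirstViolation.toggle (h : IsFirstViolation K k i j T) :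
    IsFirstViolation K k i j (T.toggle k i j h.2.1.1 h.2.1.2.1) :=
  h.congr (fun _ hc => (toggle_entry_of_lt hc).symm)
    (fun _ _ ht => (mem_toggle (by tauto)).symm) fun _ hi => (toggle_mem_above hi).symm

lemma not_both_iff (h : k + 1 ∈ T.entry (i, j)) :
    (∀ j' ≤ j, ¬ (k ∈ T.entry (i, j') ∧ k + 1 ∈ T.entry (i, j'))) ↔
      k ∉ T.entry (i, T.firstCol k i) := by
  constructor
  · exact fun hb hk => hb _ (firstCol_le h) ⟨hk, firstCol_mem h⟩
  · rintro hk j' - ⟨h1, h2⟩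
    rcases (firstCol_le h2).eq_or_lt with he | hlt
    · rw [he] at hk
      exact hk h1
    · have := row_mono hlt (firstCol_mem h) h1
      omega

lemma IsFirstViolation.countFrom_eq (h : IsFirstViolation K k i j T) :
    T.countFrom k (j + 1) = T.countFrom (k + 1) (j + 1) :=
  le_antisymm h.2.1.2.2
    (countFrom_succ_le_of_forall_not_violates fun i' j' hj => h.2.2.1 k h.1 i' j' (by omega))

open Classical in
lemma sum_isFirstViolation_mem (hK : ∀ k ∈ K, k + 1 < m) (k i j : ℕ) :
    ∑ T ∈ (boundedSVT nu.cells m).filter (IsFirstViolation K k i j), T.weight ∈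
      nullPolys K := by
  by_cases hk : k ∈ K
  swap
  · rw [Finset.filter_false_of_mem fun T _ h => hk h.1, Finset.sum_empty]
    exact zero_mem _
  have hkm := hK k hk
  set C := (boundedSVT nu.cells m).filter (IsFirstViolation K k i j) with hC
  set P : SVT nu.cells → Prop := fun T =>
    ∀ j' ≤ j, ¬ (k ∈ T.entry (i, j') ∧ k + 1 ∈ T.entry (i, j')) with hP
  have memC : ∀ {T}, T ∈ C ↔ T.Bounded m ∧ IsFirstViolation K k i j T := by simp [hC]
  have hbad : ∑ T ∈ C.filter (fun T => ¬ P T), T.weight =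
      - X k * ∑ T ∈ C.filter P, T.weight := by
    rw [Finset.mul_sum]
    symm
    have key : ∀ T, T ∈ C → ∀ h h', T.toggle k i j h h' ∈ C ∧
        (P (T.toggle k i j h h') ↔ ¬ P T) := by
      intro T hT h h'
      have hf := (memC.1 hT).2
      refine ⟨memC.2 ⟨(memC.1 hT).1.toggle (by omega), hf.toggle⟩, ?_⟩
      simp only [hP]
      rw [not_both_iff h, not_both_iff hf.toggle.2.1.1, firstCol_toggle]
      exact mem_toggleEntry_self.not
    refine Finset.sum_bij'
      (fun T hT => T.toggle k i j (memC.1 (Finset.mem_filter.1 hT).1).2.2.1.1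
        (memC.1 (Finset.mem_filter.1 hT).1).2.2.1.2.1)
      (fun T hT => T.toggle k i j (memC.1 (Finset.mem_filter.1 hT).1).2.2.1.1
        (memC.1 (Finset.mem_filter.1 hT).1).2.2.1.2.1) ?_ ?_ ?_ ?_ ?_
    · intro T hT
      obtain ⟨h1, h2⟩ := Finset.mem_filter.1 hT
      exact Finset.mem_filter.2 ⟨(key T h1 _ _).1, fun h => (key T h1 _ _).2.1 h h2⟩
    · intro T hT
      obtain ⟨h1, h2⟩ := Finset.mem_filter.1 hT
      exact Finset.mem_filter.2 ⟨(key T h1 _ _).1, (key T h1 _ _).2.2 h2⟩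
    · exact fun T _ => toggle_toggle _ _
    · exact fun T _ => toggle_toggle _ _
    · intro T hT
      obtain ⟨h1, h2⟩ := Finset.mem_filter.1 hT
      exact (weight_toggle (memC.1 h1).1 (by omega)
        ((not_both_iff (memC.1 h1).2.2.1.1).1 h2)).symm
  have hgood : rename (Equiv.swap k (k + 1)) (X k * ∑ T ∈ C.filter P, T.weight) =
      X k * ∑ T ∈ C.filter P, T.weight := by
    rw [Finset.mul_sum, map_sum]
    have hcol : ∀ T ∈ C.filter P, ∀ i', k ∉ T.entry (i', j) := fun T hT =>
      (memC.1 (Finset.mem_filter.1 hT).1).2.not_mem_column (Finset.mem_filter.1 hT).2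
    have key : ∀ T (hT : T ∈ C.filter P), T.flip k j (hcol T hT) ∈ C.filter P := by
      intro T hT
      obtain ⟨h1, h2⟩ := Finset.mem_filter.1 hT
      exact Finset.mem_filter.2 ⟨memC.2 ⟨(memC.1 h1).1.flip hkm, (memC.1 h1).2.flip⟩,
        flip_not_both le_rfl h2⟩
    refine Finset.sum_bij' (fun T hT => T.flip k j (hcol T hT))
      (fun T hT => T.flip k j (hcol T hT)) key key (fun T _ => flip_flip _)
      (fun T _ => flip_flip _) ?_
    intro T hT
    obtain ⟨h1, h2⟩ := memC.1 (Finset.mem_filter.1 hT).1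
    have e1 := countFrom_of_forall_not_mem (hcol T hT)
    have e2 := countFrom_of_mem h2.2.1.1
    have e3 := h2.countFrom_eq
    have := rename_swap_weight hkm h1 (h1.flip (hT := hcol T hT) hkm) 1 (fun t => by
      rw [countFrom_flip, countFrom_zero_eq_add _ _ j]
      rcases eq_or_ne t k with rfl | ht
      · simp only [Equiv.swap_apply_left]
        split_ifs <;> omega
      · rcases eq_or_ne t (k + 1) with rfl | ht'
        · simp only [Equiv.swap_apply_right]
          split_ifs <;> omega
        · rw [Equiv.swap_apply_of_ne_of_ne ht ht'])
    simpa using this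
  rw [← Finset.sum_filter_add_sum_filter_not C P, hbad]
  refine AddSubgroup.subset_closure ⟨k, hk, ?_⟩
  set s := ∑ T ∈ C.filter P, T.weight
  rw [show X k * (1 - X (k + 1)) * (s + - X k * s) =
    (1 - X k) * (1 - X (k + 1)) * (X k * s) by ring, map_mul, hgood]
  simp only [map_mul, map_sub, map_one, rename_X, Equiv.swap_apply_left, Equiv.swap_apply_right]
  ring

open Classical in
/-- Modulo `nullPolys K`, only the tableaux satisfying the lattice condition for all letters in
`K` contribute to a Grothendieck polynomial. -/
theorem grothendieck_sub_sum_mem (nu : YoungDiagram) (hK : ∀ k ∈ K, k + 1 < m) :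
    grothendieck nu.cells m - ∑ T ∈ (boundedSVT nu.cells m).filter
      (fun T => ∀ t ∈ K, ∀ i j, ¬ T.Violates t i j), T.weight ∈ nullPolys K := by
  rw [grothendieck_eq_sum, ← Finset.sum_filter_add_sum_filter_not (boundedSVT nu.cells m)
    (fun T => ∀ t ∈ K, ∀ i j, ¬ T.Violates t i j), add_sub_cancel_left]
  set B := (boundedSVT nu.cells m).filter
    (fun T => ¬ ∀ t ∈ K, ∀ i j, ¬ T.Violates t i j) with hB
  have hex : ∀ T ∈ B, ∃ x : ℕ × ℕ × ℕ, IsFirstViolation K x.1 x.2.1 x.2.2 T := by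
    intro T hT
    obtain ⟨-, h⟩ := Finset.mem_filter.1 hT
    push Not at h
    obtain ⟨k, i, j, h⟩ := exists_isFirstViolation hK h
    exact ⟨(k, i, j), h⟩
  set g : SVT nu.cells → ℕ × ℕ × ℕ := fun T =>
    if h : ∃ x : ℕ × ℕ × ℕ, IsFirstViolation K x.1 x.2.1 x.2.2 T then h.choose else 0 with hg
  rw [← Finset.sum_fiberwise_of_maps_to (t := B.image g) (g := g)
    (fun T hT => Finset.mem_image_of_mem g hT)]
  refine sum_mem fun x _ => ?_
  convert sum_isFirstViolation_mem (nu := nu) hK x.1 x.2.1 x.2.2 using 2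
  ext T
  simp only [hB, Finset.mem_filter]
  constructor
  · rintro ⟨h1, rfl⟩
    have h := hex T (Finset.mem_filter.2 h1)
    refine ⟨h1.1, ?_⟩
    simp only [hg, dif_pos h]
    exact h.choose_spec
  · rintro ⟨h1, h2⟩
    refine ⟨⟨h1, fun h => h _ h2.1 _ _ h2.2.1⟩, ?_⟩
    have h : ∃ x : ℕ × ℕ × ℕ, IsFirstViolation K x.1 x.2.1 x.2.2 T := ⟨x, h2⟩
    simp only [hg, dif_pos h]
    obtain ⟨e1, e2, e3⟩ := h.choose_spec.unique h2
    exact Prod.ext e1 (Prod.ext e2 e3)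

end SVT

namespace SVT

variable {nu : YoungDiagram} {T : SVT nu.cells} {m i j a : ℕ}

lemma row_le_of_mem (h : a ∈ T.entry (i, j)) : i ≤ a := by
  induction i generalizing a with
  | zero => exact Nat.zero_le a
  | succ i ih =>
    have hc : (i, j) ∈ nu.cells :=
      nu.isLowerSet (by simp : ((i, j) : ℕ × ℕ) ≤ (i + 1, j)) (T.mem_cells h)
    obtain ⟨x, hx⟩ := T.nonempty_of_mem _ hc
    exact Nat.succ_le_of_lt ((ih hx).trans_lt (col_mono (Nat.lt_succ_self i) hx h))

lemma Bounded.colLen_le (hT : T.Bounded m) : nu.colLen 0 ≤ m := by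
  by_contra! h
  obtain ⟨x, hx⟩ := T.nonempty_of_mem (m, 0) (YoungDiagram.mem_iff_lt_colLen.2 h)
  exact absurd (hT _ x hx) (row_le_of_mem hx).not_gt

/-- A tableau satisfying the lattice condition for all letters is superstandard. -/
lemma eq_row_of_forall_not_violates (hT : T.Bounded m)
    (h : ∀ t, t + 1 < m → ∀ i j, ¬ T.Violates t i j) (ha : a ∈ T.entry (i, j)) : a = i := by
  obtain ⟨M, hM⟩ : ∃ M, ∀ c ∈ nu.cells, c.2 < M :=
    ⟨nu.cells.sup Prod.snd + 1, fun c hc => Nat.lt_succ_of_le (Finset.le_sup (f := Prod.snd) hc)⟩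
  obtain ⟨d, hd⟩ : ∃ d, M ≤ j + d := ⟨M, by omega⟩
  induction d generalizing i j a with
  | zero => exact absurd (hM _ (T.mem_cells ha)) (by simp only; omega)
  | succ d ih =>
    induction i using Nat.strong_induction_on generalizing a with
    | _ i ihi =>
      refine le_antisymm ?_ (row_le_of_mem ha)
      by_contra! hlt
      obtain ⟨t, rfl⟩ : ∃ t, a = t + 1 := ⟨a - 1, by omega⟩
      refine h t (hT _ _ ha) i j ⟨ha, fun i' hi' ht => ?_, ?_⟩
      · have := ihi i' hi' ht
        omega
      · refine le_of_eq_of_le (Finset.card_eq_zero.2 (Finset.filter_eq_empty_iff.2 ?_))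
          (Nat.zero_le _)
        rintro ⟨r, u⟩ hc ⟨hu, ht⟩
        simp only at hu
        obtain rfl := ih ht (by omega)
        have hc' : (i, u) ∈ nu.cells := nu.isLowerSet
          (by simp; omega : ((i, u) : ℕ × ℕ) ≤ (t, u)) hc
        obtain ⟨x, hx⟩ := T.nonempty_of_mem _ hc'
        have h1 := ih hx (by omega)
        have h2 := row_mono (by omega) ha hx
        omega

/-- The superstandard tableau of shape `nu`. -/
def superstandard (nu : YoungDiagram) : SVT nu.cells where
  entry c := if c ∈ nu.cells then {c.1} else ∅
  nonempty_of_mem c hc := by simp [hc]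
  eq_empty_of_not_mem c hc := by simp [hc]
  row_weak i j h1 h2 a ha b hb := by
    simp only [h1, h2, if_true, Finset.mem_singleton] at ha hb
    omega
  col_strict i j h1 h2 a ha b hb := by
    simp only [h1, h2, if_true, Finset.mem_singleton] at ha hb
    omega

lemma mem_superstandard : a ∈ (superstandard nu).entry (i, j) ↔ (i, j) ∈ nu.cells ∧ a = i := by
  change a ∈ (if _ then _ else _) ↔ _
  split_ifs with h <;> simp [h]

lemma bounded_superstandard (h : nu.colLen 0 ≤ m) : (superstandard nu).Bounded m := by
  rintro ⟨i, j⟩ x hx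
  obtain ⟨hc, rfl⟩ := mem_superstandard.1 hx
  have := YoungDiagram.mem_iff_lt_colLen.1 hc
  have := nu.colLen_anti 0 j (Nat.zero_le j)
  omega

lemma not_violates_superstandard (t i j : ℕ) : ¬ (superstandard nu).Violates t i j := by
  rintro ⟨h1, h2, -⟩
  obtain ⟨hc, rfl⟩ := mem_superstandard.1 h1
  exact h2 t (Nat.lt_succ_self t) (mem_superstandard.2
    ⟨nu.isLowerSet (by simp : ((t, j) : ℕ × ℕ) ≤ (t + 1, j)) hc, rfl⟩)

lemma countFrom_superstandard (t : ℕ) : (superstandard nu).countFrom t 0 = nu.rowLen t := by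
  rw [countFrom_zero, YoungDiagram.rowLen_eq_card, YoungDiagram.row]
  congr 1
  refine Finset.filter_congr ?_
  rintro ⟨i, j⟩ hc
  rw [mem_superstandard]
  exact ⟨fun h => h.2.symm, fun h => ⟨hc, h.symm⟩⟩

end SVT

open SVT

theorem grothendieck_eq_zero {nu : YoungDiagram} {m : ℕ} (h : m < nu.colLen 0) :
    grothendieck nu.cells m = 0 := by
  rw [grothendieck_eq_sum]
  refine Finset.sum_eq_zero fun T hT => ?_
  have := (mem_boundedSVT.1 hT).colLen_le
  omega

/-- A Grothendieck polynomial agrees with its leading monomial modulo `nullPolys`. -/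
theorem grothendieck_sub_prod_mem {nu : YoungDiagram} {m : ℕ} (h : nu.colLen 0 ≤ m) :
    grothendieck nu.cells m - ∏ t ∈ Finset.range m, X t ^ nu.rowLen t ∈
      nullPolys {k | k + 1 < m} := by
  classical
  have hS := bounded_superstandard h
  have hmem := grothendieck_sub_sum_mem (K := {k | k + 1 < m}) (m := m) nu fun k hk => hk
  have hgood : (boundedSVT nu.cells m).filter
      (fun T => ∀ t ∈ {k | k + 1 < m}, ∀ i j, ¬ T.Violates t i j) = {superstandard nu} := by
    refine Finset.eq_singleton_iff_unique_mem.2 ⟨Finset.mem_filter.2 ⟨mem_boundedSVT.2 hS,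
      fun t _ => not_violates_superstandard t⟩, fun T hT => ?_⟩
    obtain ⟨h1, h2⟩ := Finset.mem_filter.1 hT
    rw [mem_boundedSVT] at h1
    refine ext_entry ?_
    rintro ⟨i, j⟩
    ext a
    rw [mem_superstandard]
    refine ⟨fun ha => ⟨T.mem_cells ha, eq_row_of_forall_not_violates h1 h2 ha⟩, ?_⟩
    rintro ⟨hc, rfl⟩
    obtain ⟨x, hx⟩ := T.nonempty_of_mem _ hc
    obtain rfl := eq_row_of_forall_not_violates h1 h2 hx
    exact hx
  have hsize : (superstandard nu).size = nu.cells.card := by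
    rw [SVT.size, Finset.card_eq_sum_ones]
    refine Finset.sum_congr rfl fun c hc => ?_
    change (if c ∈ nu.cells then _ else _ : Finset ℕ).card = 1
    rw [if_pos hc, Finset.card_singleton]
  convert hmem using 2
  rw [Finset.sum_congr (s₂ := {superstandard nu}) (by convert hgood) fun _ _ => rfl,
    Finset.sum_singleton, weight, hsize, Nat.sub_self, pow_zero, one_smul, hS.monomial_eq]
  simp only [countFrom_superstandard]

/-! ### The lattice condition on words -/

/-- Every suffix of `w` contains at least as many letters `t` as letters `t + 1`. -/
def IsLatticeAt (t : ℕ) (w : List ℕ) : Prop := ∀ s, s <:+ w → s.count (t + 1) ≤ s.count t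

/-- Some letter `t + 1` of `w` is not followed by a letter `t`. -/
def HasUnmatched (t : ℕ) (w : List ℕ) : Prop := ∃ v, (t + 1) :: v <:+ w ∧ t ∉ v

section Words

variable {t : ℕ} {l l₁ l₂ : List ℕ}

lemma suffix_append_iff_or {s : List ℕ} :
    s <:+ l₁ ++ l₂ ↔ s <:+ l₂ ∨ ∃ s', s' <:+ l₁ ∧ s = s' ++ l₂ := by
  constructor
  · rintro ⟨u, hu⟩
    rcases List.append_eq_append_iff.1 hu with ⟨a, h1, h2⟩ | ⟨a, h1, h2⟩
    · exact Or.inr ⟨a, ⟨u, h1.symm⟩, h2⟩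
    · exact Or.inl ⟨a, h2.symm⟩
  · rintro (h | ⟨s', ⟨u, rfl⟩, rfl⟩)
    · exact h.trans (List.suffix_append _ _)
    · exact ⟨u, by simp⟩

lemma hasUnmatched_append :
    HasUnmatched t (l₁ ++ l₂) ↔ HasUnmatched t l₂ ∨ (HasUnmatched t l₁ ∧ t ∉ l₂) := by
  constructor
  · rintro ⟨v, hv, ht⟩
    rcases suffix_append_iff_or.1 hv with h | ⟨s', h1, h2⟩
    · exact Or.inl ⟨v, h, ht⟩
    · cases s' with
      | nil =>
        rw [List.nil_append] at h2
        exact Or.inl ⟨v, h2 ▸ List.suffix_refl _, ht⟩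
      | cons x s' =>
        rw [List.cons_append, List.cons.injEq] at h2
        obtain ⟨rfl, rfl⟩ := h2
        rw [List.mem_append, not_or] at ht
        exact Or.inr ⟨⟨s', h1, ht.1⟩, ht.2⟩
  · rintro (⟨v, hv, ht⟩ | ⟨⟨v, ⟨u, hu⟩, ht⟩, ht'⟩)
    · exact ⟨v, hv.trans (List.suffix_append _ _), ht⟩
    · exact ⟨v ++ l₂, ⟨u, by rw [← hu]; simp⟩, by simp [ht, ht']⟩

lemma hasUnmatched_sort {S : Finset ℕ} :
    HasUnmatched t (S.sort (· ≤ ·)) ↔ t + 1 ∈ S := by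
  constructor
  · rintro ⟨v, hv, -⟩
    exact (Finset.mem_sort _).1 (hv.subset List.mem_cons_self)
  · intro h
    obtain ⟨u, v, huv⟩ := List.append_of_mem ((Finset.mem_sort (· ≤ ·)).2 h)
    refine ⟨v, ⟨u, huv.symm⟩, fun ht => ?_⟩
    have hs := Finset.pairwise_sort S (· ≤ ·)
    rw [huv, List.pairwise_append, List.pairwise_cons] at hs
    have := hs.2.1.1 t ht
    omega

lemma isLatticeAt_append :
    IsLatticeAt t (l₁ ++ l₂) ↔ IsLatticeAt t l₂ ∧ ∀ s, s <:+ l₁ →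
      s.count (t + 1) + l₂.count (t + 1) ≤ s.count t + l₂.count t := by
  constructor
  · refine fun h => ⟨fun s hs => h s (suffix_append_iff_or.2 (Or.inl hs)), fun s hs => ?_⟩
    simpa using h (s ++ l₂) (suffix_append_iff_or.2 (Or.inr ⟨s, hs, rfl⟩))
  · rintro ⟨h1, h2⟩ s hs
    rcases suffix_append_iff_or.1 hs with h | ⟨s', h, rfl⟩
    · exact h1 s h
    · simpa using h2 s' h

lemma forall_suffix_iff {a b : ℕ} (hl : l.count (t + 1) ≤ 1) (hab : b ≤ a) :
    (∀ s, s <:+ l → s.count (t + 1) + b ≤ s.count t + a) ↔ ¬ (HasUnmatched t l ∧ a ≤ b) := by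
  constructor
  · rintro h ⟨⟨v, hv, ht⟩, hle⟩
    have := h _ hv
    rw [List.count_cons_self, List.count_cons_of_ne (by omega),
      List.count_eq_zero_of_not_mem ht] at this
    omega
  · intro h s hs
    by_cases h1 : t + 1 ∈ s
    · have h2 := hs.sublist.count_le (t + 1)
      by_cases h3 : t ∈ s
      · have := List.count_pos_iff.2 h3
        omega
      · obtain ⟨u, v, rfl⟩ := List.append_of_mem h1
        have : ¬ a ≤ b := fun hle => h ⟨⟨v, (List.suffix_append _ _).trans hs, by
          simp at h3; tauto⟩, hle⟩
        omega
    · rw [List.count_eq_zero_of_not_mem h1]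
      omega

end Words

namespace SVT

/-- The word of the first `n` boxes of column `j`. -/
def colWord {cells : Finset (ℕ × ℕ)} (T : SVT cells) (j n : ℕ) : List ℕ :=
  (List.range n).reverse.flatMap fun i => (T.entry (i, j)).sort (· ≤ ·)

variable {nu : YoungDiagram} {T : SVT nu.cells} {j n t : ℕ}

lemma colWord_succ : T.colWord j (n + 1) =
    (T.entry (n, j)).sort (· ≤ ·) ++ T.colWord j n := by
  simp [colWord, List.range_succ]

lemma mem_colWord : t ∈ T.colWord j n ↔ ∃ i < n, t ∈ T.entry (i, j) := by
  simp [colWord]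

lemma count_colWord_of_mem {i : ℕ} (hi : i < n) (h : t ∈ T.entry (i, j)) :
    (T.colWord j n).count t = 1 := by
  induction n with
  | zero => omega
  | succ n ih =>
    rw [colWord_succ, List.count_append]
    rcases Nat.lt_succ_iff_lt_or_eq.1 hi with hlt | rfl
    · have h0 : t ∉ (T.entry (n, j)).sort (· ≤ ·) := fun h' =>
        hlt.ne (row_unique h ((Finset.mem_sort _).1 h'))
      rw [ih hlt, List.count_eq_zero_of_not_mem h0]
    · have h0 : t ∉ T.colWord j i := fun h' => by
        obtain ⟨i', hi', h'⟩ := mem_colWord.1 h'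
        exact hi'.ne (row_unique h' h)
      rw [List.count_eq_zero_of_not_mem h0, List.count_eq_one_of_mem (Finset.sort_nodup _ _)
        ((Finset.mem_sort _).2 h)]

lemma count_colWord_le : (T.colWord j n).count t ≤ 1 := by
  by_cases h : t ∈ T.colWord j n
  · obtain ⟨i, hi, h⟩ := mem_colWord.1 h
    exact (count_colWord_of_mem hi h).le
  · rw [List.count_eq_zero_of_not_mem h]
    exact Nat.zero_le 1

lemma hasUnmatched_colWord : HasUnmatched t (T.colWord j n) ↔
    ∃ i < n, t + 1 ∈ T.entry (i, j) ∧ ∀ i' < i, t ∉ T.entry (i', j) := by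
  induction n with
  | zero => simp [colWord, HasUnmatched]
  | succ n ih =>
    rw [colWord_succ, hasUnmatched_append, hasUnmatched_sort, ih, mem_colWord]
    constructor
    · rintro (⟨i, hi, h⟩ | ⟨h1, h2⟩)
      · exact ⟨i, by omega, h⟩
      · exact ⟨n, by omega, h1, fun i' hi' h => h2 ⟨i', hi', h⟩⟩
    · rintro ⟨i, hi, h1, h2⟩
      rcases Nat.lt_succ_iff_lt_or_eq.1 hi with hlt | rfl
      · exact Or.inl ⟨i, hlt, h1, h2⟩
      · exact Or.inr ⟨h1, fun ⟨i', hi', h⟩ => h2 i' hi' h⟩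

lemma count_flatMap_colWord (hn : ∀ c ∈ nu.cells, c.1 < n) (d : ℕ)
    (hd : ∀ c ∈ nu.cells, c.2 < j + d) :
    ((List.range' j d).flatMap fun u => T.colWord u n).count t = T.countFrom t j := by
  induction d generalizing j with
  | zero =>
    rw [countFrom, Finset.card_eq_zero.2]
    · simp
    · refine Finset.filter_eq_empty_iff.2 fun c hc hc' => ?_
      have := hd c hc
      omega
  | succ d ih =>
    rw [List.range'_succ, List.flatMap_cons, List.count_append,
      ih fun c hc => by have := hd c hc; omega]
    by_cases h : ∃ i, t ∈ T.entry (i, j)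
    · obtain ⟨i, hi⟩ := h
      rw [count_colWord_of_mem (hn _ (T.mem_cells hi)) hi, countFrom_of_mem hi, add_comm]
    · push Not at h
      rw [List.count_eq_zero_of_not_mem, countFrom_of_forall_not_mem h, zero_add]
      exact fun h' => by
        obtain ⟨i, -, hi⟩ := mem_colWord.1 h'
        exact h i hi

lemma isLatticeAt_flatMap_colWord (hn : ∀ c ∈ nu.cells, c.1 < n) (d : ℕ)
    (hd : ∀ c ∈ nu.cells, c.2 < j + d) :
    IsLatticeAt t ((List.range' j d).flatMap fun u => T.colWord u n) ↔
      ∀ i j', j ≤ j' → ¬ T.Violates t i j' := by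
  induction d generalizing j with
  | zero =>
    refine iff_of_true (fun s hs => ?_) fun i j' hj h => ?_
    · rw [List.range'_zero, List.flatMap_nil, List.suffix_nil] at hs
      simp [hs]
    · have := hd _ (T.mem_cells h.1)
      simp only at this
      omega
  | succ d ih =>
    have hd' : ∀ c ∈ nu.cells, c.2 < j + 1 + d := fun c hc => by have := hd c hc; omega
    rw [List.range'_succ, List.flatMap_cons, isLatticeAt_append]
    have h1 : IsLatticeAt t ((List.range' (j + 1) d).flatMap fun u => T.colWord u n) → _ :=
      fun h => forall_suffix_iff (a := T.countFrom t (j + 1)) (b := T.countFrom (t + 1) (j + 1))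
        (t := t) (l := T.colWord j n) count_colWord_le (by
          rw [← count_flatMap_colWord hn d hd', ← count_flatMap_colWord hn d hd']
          exact h _ (List.suffix_refl _))
    rw [count_flatMap_colWord hn d hd', count_flatMap_colWord hn d hd', and_congr_right h1,
      ih hd', hasUnmatched_colWord]
    constructor
    · rintro ⟨h2, h3⟩ i j' hj hv
      rcases hj.eq_or_lt with rfl | hlt
      · exact h3 ⟨⟨i, hn _ (T.mem_cells hv.1), hv.1, hv.2.1⟩, hv.2.2⟩
      · exact h2 i j' hlt hv
    · refine fun h => ⟨fun i j' hj => h i j' (by omega), ?_⟩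
      rintro ⟨⟨i, -, h2, h3⟩, h4⟩
      exact h i j le_rfl ⟨h2, h3, h4⟩

lemma word_eq (T : SVT nu.cells) : ∃ N, (∀ c ∈ nu.cells, c.1 < N) ∧
    (∀ c ∈ nu.cells, c.2 < 0 + N) ∧
      T.word = (List.range' 0 N).flatMap fun u => T.colWord u N := by
  have h := fun c hc => Finset.le_sup (f := fun c : ℕ × ℕ => max c.1 c.2) (s := nu.cells) (b := c) hc
  refine ⟨(nu.cells.sup fun c => max c.1 c.2) + 1, fun c hc => ?_, fun c hc => ?_, ?_⟩
  · have := h c hc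
    omega
  · have := h c hc
    omega
  · rw [← List.range_eq_range']
    rfl

lemma count_word (T : SVT nu.cells) (t : ℕ) : T.word.count t = T.countFrom t 0 := by
  obtain ⟨N, h1, h2, h3⟩ := T.word_eq
  rw [h3, count_flatMap_colWord h1 N h2]

lemma isLatticeAt_word (T : SVT nu.cells) (t : ℕ) :
    IsLatticeAt t T.word ↔ ∀ i j, ¬ T.Violates t i j := by
  obtain ⟨N, h1, h2, h3⟩ := T.word_eq
  rw [h3, isLatticeAt_flatMap_colWord h1 N h2]
  simp

lemma isPartialRLW_word (T : SVT nu.cells) (a b : ℕ) : IsPartialRLW a b T.word ↔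
    ∀ t, a ≤ t → t + 1 < b → ∀ i j, ¬ T.Violates t i j := by
  simp only [← isLatticeAt_word]
  exact ⟨fun h t h1 h2 s hs => h s hs t h1 h2, fun h s hs t h1 h2 => h t h1 h2 s hs⟩

end SVT

/-! ### Young diagrams with prescribed row lengths -/

namespace YoungDiagram

variable {lam mu : YoungDiagram} {m i : ℕ}

lemma eq_of_rowLen (h : ∀ i, lam.rowLen i = mu.rowLen i) : lam = mu := by
  ext ⟨i, j⟩
  rw [mem_cells, mem_cells, mem_iff_lt_rowLen, mem_iff_lt_rowLen, h]

lemma rowLen_eq_zero (h : lam.colLen 0 ≤ i) : lam.rowLen i = 0 := by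
  by_contra h0
  have := mem_iff_lt_colLen.1 (mem_iff_lt_rowLen.2 (Nat.pos_of_ne_zero h0))
  omega

lemma card_eq_sum_rowLen (h : lam.colLen 0 ≤ m) :
    lam.card = ∑ i ∈ Finset.range m, lam.rowLen i := by
  simp only [rowLen_eq_card, row]
  refine Finset.card_eq_sum_card_fiberwise fun c hc => ?_
  have h1 := mem_iff_lt_colLen.1 (show (c.1, c.2) ∈ lam from hc)
  have h2 := lam.colLen_anti 0 c.2 (Nat.zero_le _)
  simp only [Finset.coe_range, Set.mem_Iio]
  omega

/-- The Young diagram with row lengths `f 0, …, f (n - 1)`, provided these decrease weakly. -/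
def ofRows (n : ℕ) (f : ℕ → ℕ) : YoungDiagram where
  cells := (Finset.range n ×ˢ Finset.range (f 0)).filter fun c => ∀ i ≤ c.1, c.2 < f i
  isLowerSet := by
    rintro ⟨a, b⟩ ⟨a', b'⟩ ⟨h1, h2⟩ h
    simp only [Finset.coe_filter, Finset.mem_product, Finset.mem_range, Set.mem_ofPred_eq]
      at h h1 h2 ⊢
    exact ⟨⟨by omega, by omega⟩, fun i hi => h2.trans_lt (h.2 i (hi.trans h1))⟩

variable {n : ℕ} {f : ℕ → ℕ}

lemma mem_ofRows {j : ℕ} : (i, j) ∈ ofRows n f ↔ i < n ∧ ∀ i' ≤ i, j < f i' := by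
  rw [← mem_cells]
  simp only [ofRows, Finset.mem_filter, Finset.mem_product, Finset.mem_range]
  exact ⟨fun h => ⟨h.1.1, h.2⟩, fun h => ⟨⟨h.1, h.2 0 (Nat.zero_le i)⟩, h.2⟩⟩

lemma colLen_ofRows_le : (ofRows n f).colLen 0 ≤ n := by
  by_contra! h
  exact absurd (mem_ofRows.1 (mem_iff_lt_colLen.2 h)).1 (lt_irrefl n)

lemma rowLen_ofRows (hf : ∀ i, i + 1 < n → f (i + 1) ≤ f i) (hi : i < n) :
    (ofRows n f).rowLen i = f i := by
  have key : ∀ d i', i' + d < n → f (i' + d) ≤ f i' := by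
    intro d
    induction d with
    | zero => exact fun i' _ => le_rfl
    | succ d ih => exact fun i' h => (hf (i' + d) h).trans (ih i' (by omega))
  refine eq_of_forall_lt_iff fun j => ?_
  rw [← mem_iff_lt_rowLen, mem_ofRows]
  refine ⟨fun h => h.2 i le_rfl, fun h => ⟨hi, fun i' hi' => h.trans_le ?_⟩⟩
  obtain ⟨d, rfl⟩ := Nat.exists_eq_add_of_le hi'
  exact key d i' hi

end YoungDiagram

open YoungDiagram

namespace SVT

variable {lam mu nu : YoungDiagram} {T : SVT nu.cells} {p q t : ℕ}

lemma countFrom_pos {c : ℕ × ℕ} (h : t ∈ T.entry c) : 0 < T.countFrom t 0 :=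
  Finset.card_pos.2 ⟨c, Finset.mem_filter.2 ⟨T.mem_cells h, Nat.zero_le _, h⟩⟩

lemma countFrom_eq_zero (h : ∀ c, t ∉ T.entry c) (j : ℕ) : T.countFrom t j = 0 :=
  Finset.card_eq_zero.2 (Finset.filter_eq_empty_iff.2 fun c _ hc => h c hc.2)

/-- `T` satisfies the lattice condition for the letters in `[0, a)` and in `[a, a + b)`, and its
content is given by the rows of `lam` followed by the rows of `mu`, starting from letter `a`. -/
def IsLR (a b : ℕ) (lam mu : YoungDiagram) (T : SVT nu.cells) : Prop :=
  (∀ t, t + 1 < a → ∀ i j, ¬ T.Violates t i j) ∧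
    (∀ t, a ≤ t → t + 1 < a + b → ∀ i j, ¬ T.Violates t i j) ∧
    ∀ i, T.countFrom i 0 = if i < a then lam.rowLen i else mu.rowLen (i - a)

/-! ### Mapping the letters -/

/-- Apply a map to all letters, strictly increasing on the letters that occur. -/
def mapLetters (T : SVT nu.cells) (f : ℕ → ℕ) (hf : StrictMonoOn f {a | ∃ c, a ∈ T.entry c}) :
    SVT nu.cells where
  entry c := (T.entry c).image f
  nonempty_of_mem c hc := (T.nonempty_of_mem c hc).image f
  eq_empty_of_not_mem c hc := by rw [T.eq_empty_of_not_mem c hc, Finset.image_empty]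
  row_weak i j h h' a ha b hb := by
    obtain ⟨x, hx, rfl⟩ := Finset.mem_image.1 ha
    obtain ⟨y, hy, rfl⟩ := Finset.mem_image.1 hb
    exact hf.monotoneOn ⟨_, hx⟩ ⟨_, hy⟩ (T.row_weak i j h h' x hx y hy)
  col_strict i j h h' a ha b hb := by
    obtain ⟨x, hx, rfl⟩ := Finset.mem_image.1 ha
    obtain ⟨y, hy, rfl⟩ := Finset.mem_image.1 hb
    exact hf ⟨_, hx⟩ ⟨_, hy⟩ (T.col_strict i j h h' x hx y hy)

/-- The map increasing the letters `≥ l` by `d`. -/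
def gap (l d i : ℕ) : ℕ := if i < l then i else i + d

lemma gap_strictMono (l d : ℕ) : StrictMono (gap l d) := by
  intro a b h
  simp only [gap]
  split_ifs <;> omega

/-- The tableau obtained by increasing the letters `≥ l` by `d`. -/
def addGap (T : SVT nu.cells) (l d : ℕ) : SVT nu.cells :=
  T.mapLetters (gap l d) ((gap_strictMono l d).strictMonoOn _)

variable {l d : ℕ}

lemma mem_addGap {c : ℕ × ℕ} : gap l d t ∈ (T.addGap l d).entry c ↔ t ∈ T.entry c := by
  simp [addGap, mapLetters, (gap_strictMono l d).injective.eq_iff]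

lemma mem_addGap_of_lt (h : t < l) {c : ℕ × ℕ} :
    t ∈ (T.addGap l d).entry c ↔ t ∈ T.entry c := by
  have := mem_addGap (T := T) (l := l) (d := d) (t := t) (c := c)
  rwa [gap, if_pos h] at this

lemma mem_addGap_of_ge (h : l ≤ t) {c : ℕ × ℕ} :
    t + d ∈ (T.addGap l d).entry c ↔ t ∈ T.entry c := by
  have := mem_addGap (T := T) (l := l) (d := d) (t := t) (c := c)
  rwa [gap, if_neg (by omega)] at this

lemma not_mem_addGap (h : l ≤ t) (h' : t < l + d) (c : ℕ × ℕ) :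
    t ∉ (T.addGap l d).entry c := by
  intro ht
  obtain ⟨a, -, ha⟩ := Finset.mem_image.1 (show t ∈ (T.entry c).image (gap l d) from ht)
  rw [gap] at ha
  split_ifs at ha <;> omega

lemma countFrom_congr_of_iff {T T' : SVT nu.cells} {t t' : ℕ}
    (h : ∀ c, t ∈ T.entry c ↔ t' ∈ T'.entry c) (j : ℕ) :
    T.countFrom t j = T'.countFrom t' j := by
  simp only [countFrom, h]

lemma violates_congr_of_iff {T T' : SVT nu.cells} {t t' : ℕ}
    (h : ∀ c, t ∈ T.entry c ↔ t' ∈ T'.entry c)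
    (h1 : ∀ c, t + 1 ∈ T.entry c ↔ t' + 1 ∈ T'.entry c) (i j : ℕ) :
    T.Violates t i j ↔ T'.Violates t' i j := by
  simp only [Violates, h, h1, countFrom_congr_of_iff h, countFrom_congr_of_iff h1]

lemma isLR_addGap (h : lam.colLen 0 + d = p) (hq : mu.colLen 0 ≤ q) :
    (T.addGap (lam.colLen 0) d).IsLR p q lam mu ↔
      T.IsLR (lam.colLen 0) (mu.colLen 0) lam mu := by
  set l := lam.colLen 0 with hl
  have hlow : ∀ t, t + 1 < l → ∀ i j, ((T.addGap l d).Violates t i j ↔ T.Violates t i j) :=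
    fun t ht => violates_congr_of_iff (fun c => mem_addGap_of_lt (by omega))
      fun c => mem_addGap_of_lt ht
  have hhigh : ∀ t, l ≤ t → ∀ i j,
      ((T.addGap l d).Violates (t + d) i j ↔ T.Violates t i j) :=
    fun t ht => violates_congr_of_iff (fun c => mem_addGap_of_ge ht) fun c => by
      rw [add_right_comm]
      exact mem_addGap_of_ge (by omega)
  have c1 : ∀ t, t < l → (T.addGap l d).countFrom t 0 = T.countFrom t 0 := fun t ht =>
    countFrom_congr_of_iff (fun c => mem_addGap_of_lt ht) 0
  have c2 : ∀ t, l ≤ t → (T.addGap l d).countFrom (t + d) 0 = T.countFrom t 0 := fun t ht =>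
    countFrom_congr_of_iff (fun c => mem_addGap_of_ge ht) 0
  constructor
  · rintro ⟨h1, h2, h3⟩
    refine ⟨fun t ht i j => ?_, fun t ht ht' i j => ?_, fun i => ?_⟩
    · rw [← hlow t ht]
      exact h1 t (by omega) i j
    · rw [← hhigh t ht]
      exact h2 (t + d) (by omega) (by omega) i j
    · split_ifs with hi
      · rw [← c1 i hi, h3, if_pos (by omega)]
      · rw [← c2 i (by omega), h3, if_neg (by omega), show i + d - p = i - l by omega]
  · rintro ⟨h1, h2, h3⟩
    refine ⟨fun t ht i j => ?_, fun t ht ht' i j => ?_, fun i => ?_⟩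
    · rcases Nat.lt_or_ge (t + 1) l with h4 | h4
      · rw [hlow t h4]
        exact h1 t h4 i j
      · exact fun hv => not_mem_addGap h4 (by omega) _ hv.1
    · obtain ⟨t, rfl⟩ : ∃ s, t = s + d := ⟨t - d, by omega⟩
      rw [hhigh t (by omega)]
      rcases Nat.lt_or_ge (t + 1) (l + mu.colLen 0) with h4 | h4
      · exact h2 t (by omega) h4 i j
      · intro hv
        have h5 := countFrom_pos hv.1
        rw [h3, if_neg (by omega), rowLen_eq_zero (by omega)] at h5
        exact lt_irrefl _ h5
    · split_ifs with hi
      · rcases Nat.lt_or_ge i l with h4 | h4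
        · rw [c1 i h4, h3, if_pos h4]
        · rw [rowLen_eq_zero h4, countFrom_eq_zero (not_mem_addGap h4 (by omega))]
      · obtain ⟨i, rfl⟩ : ∃ s, i = s + d := ⟨i - d, by omega⟩
        rw [c2 i (by omega), h3, if_neg (by omega), show i + d - p = i - l by omega]

lemma addGap_injective : Function.Injective fun T : SVT nu.cells => T.addGap l d := by
  intro T T' h
  refine ext_entry fun c => ?_
  ext t
  rw [← mem_addGap (l := l) (d := d), ← mem_addGap (T := T') (l := l) (d := d)]
  exact iff_of_eq (congrArg (fun S : SVT nu.cells => gap l d t ∈ S.entry c) h)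

lemma IsLR.exists_addGap {S : SVT nu.cells} (h : lam.colLen 0 + d = p)
    (hS : S.IsLR p q lam mu) : ∃ T : SVT nu.cells, T.addGap (lam.colLen 0) d = S := by
  have hmem : ∀ a c, a ∈ S.entry c → a < lam.colLen 0 ∨ p ≤ a := by
    intro a c ha
    by_contra! hcon
    have h1 := countFrom_pos ha
    rw [hS.2.2, if_pos hcon.2, rowLen_eq_zero hcon.1] at h1
    exact lt_irrefl _ h1
  refine ⟨S.mapLetters (fun a => if a < p then a else a - d) ?_, ext_entry fun c => ?_⟩
  · rintro a ⟨c, ha⟩ b ⟨c', hb⟩ hab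
    have h1 := hmem a c ha
    have h2 := hmem b c' hb
    simp only
    split_ifs <;> omega
  · change ((S.entry c).image _).image (gap (lam.colLen 0) d) = S.entry c
    rw [Finset.image_image]
    conv_rhs => rw [← Finset.image_id (s := S.entry c)]
    refine Finset.image_congr fun a ha => ?_
    have h1 := hmem a c ha
    simp only [Function.comp_apply, gap, id]
    split_ifs <;> omega

lemma card_isLR (hp : lam.colLen 0 ≤ p) (hq : mu.colLen 0 ≤ q) :
    Nat.card {T : SVT nu.cells // T.IsLR (lam.colLen 0) (mu.colLen 0) lam mu} =
      Nat.card {T : SVT nu.cells // T.IsLR p q lam mu} := by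
  obtain ⟨d, rfl⟩ := Nat.exists_eq_add_of_le hp
  refine Nat.card_congr (Equiv.ofBijective
    (fun T => ⟨T.1.addGap (lam.colLen 0) d, (isLR_addGap rfl hq).2 T.2⟩) ⟨?_, ?_⟩)
  · rintro ⟨T, hT⟩ ⟨T', hT'⟩ h
    exact Subtype.ext (addGap_injective (congrArg Subtype.val h))
  · rintro ⟨S, hS⟩
    obtain ⟨T, rfl⟩ := hS.exists_addGap rfl
    exact ⟨⟨T, (isLR_addGap rfl hq).1 hS⟩, rfl⟩

end SVT

lemma dCoeff_eq {lam mu nu : YoungDiagram} {p q : ℕ} (hp : lam.colLen 0 ≤ p)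
    (hq : mu.colLen 0 ≤ q) : dCoeff lam mu nu = (-1 : ℤ) ^ (lam.card + mu.card - nu.card) *
      (Nat.card {T : SVT nu.cells // T.IsLR p q lam mu} : ℤ) := by
  rw [← SVT.card_isLR hp hq, dCoeff]
  simp only [SVT.isPartialRLW_word, SVT.count_word, SVT.IsLR, Nat.zero_le, true_implies]

/-- The letters `k` such that `k` and `k + 1` are both among the first `p` letters, or both among
the `q` letters following these. -/
def blockLetters (p q : ℕ) : Set ℕ := {k | k + 1 < p ∨ (p ≤ k ∧ k + 1 < p + q)}

section Products

variable {lam mu : YoungDiagram} {p q k : ℕ}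

lemma lt_of_mem_blockLetters (h : k ∈ blockLetters p q) : k + 1 < p + q := by
  rcases h with h | h <;> omega

lemma rename_swap_rename_add_of_lt (hk : k + 1 < p) (g : MvPolynomial ℕ ℤ) :
    rename (Equiv.swap k (k + 1)) (rename (· + p) g) = rename (· + p) g := by
  rw [rename_rename]
  exact congrArg (fun f : ℕ → ℕ => rename f g) (funext fun t =>
    Equiv.swap_apply_of_ne_of_ne (by simp only; omega) (by simp only; omega))

lemma rename_swap_rename_add_of_ge (hk : p ≤ k) (g : MvPolynomial ℕ ℤ) :
    rename (Equiv.swap k (k + 1)) (rename (· + p) g) =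
      rename (· + p) (rename (Equiv.swap (k - p) (k - p + 1)) g) := by
  rw [rename_rename, rename_rename]
  refine congrArg (fun f : ℕ → ℕ => rename f g) (funext fun t => ?_)
  simp only [Function.comp_apply, Equiv.swap_apply_def]
  split_ifs <;> omega

lemma rename_swap_prod_of_le {m : ℕ} (hk : m ≤ k) (f : ℕ → ℕ) :
    rename (Equiv.swap k (k + 1)) (∏ t ∈ Finset.range m, X t ^ f t : MvPolynomial ℕ ℤ) =
      ∏ t ∈ Finset.range m, X t ^ f t := by
  rw [map_prod]
  refine Finset.prod_congr rfl fun t ht => ?_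
  have := Finset.mem_range.1 ht
  rw [map_pow, rename_X, Equiv.swap_apply_of_ne_of_ne (by omega) (by omega)]

lemma rename_swap_grothendieck_of_le {cells : Finset (ℕ × ℕ)} (hk : p ≤ k) :
    rename (Equiv.swap k (k + 1)) (grothendieck cells p) = grothendieck cells p := by
  rw [grothendieck_eq_sum, map_sum]
  refine Finset.sum_congr rfl fun T hT => ?_
  rw [weight, map_zsmul, (mem_boundedSVT.1 hT).monomial_eq, rename_swap_prod_of_le hk]

lemma rename_swap_grothendieck_mul (hk : k ∈ blockLetters p q) :
    rename (Equiv.swap k (k + 1))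
      (grothendieck lam.cells p * rename (· + p) (grothendieck mu.cells q)) =
      grothendieck lam.cells p * rename (· + p) (grothendieck mu.cells q) := by
  rw [map_mul]
  rcases hk with hk | ⟨hk, hk'⟩
  · rw [rename_swap_grothendieck lam hk, rename_swap_rename_add_of_lt hk]
  · rw [rename_swap_grothendieck_of_le hk, rename_swap_rename_add_of_ge hk,
      rename_swap_grothendieck mu (by omega)]

lemma grothendieck_mul_sub_mem (hp : lam.colLen 0 ≤ p) (hq : mu.colLen 0 ≤ q) :
    grothendieck lam.cells p * rename (· + p) (grothendieck mu.cells q) -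
      (∏ t ∈ Finset.range p, X t ^ lam.rowLen t) *
        rename (· + p) (∏ t ∈ Finset.range q, X t ^ mu.rowLen t) ∈
      nullPolys (blockLetters p q) := by
  have h1 : rename (· + p) (grothendieck mu.cells q) *
      (grothendieck lam.cells p - ∏ t ∈ Finset.range p, X t ^ lam.rowLen t) ∈
      nullPolys (blockLetters p q) :=
    nullPolys_mono (fun k hk => Or.inl hk) (mul_mem_nullPolys (grothendieck_sub_prod_mem hp)
      fun k hk => rename_swap_rename_add_of_lt hk _)
  have h2 : (∏ t ∈ Finset.range p, X t ^ lam.rowLen t) *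
      rename (· + p) (grothendieck mu.cells q - ∏ t ∈ Finset.range q, X t ^ mu.rowLen t) ∈
      nullPolys (blockLetters p q) := by
    refine nullPolys_mono (K := {k | p ≤ k ∧ k + 1 < p + q}) (fun k hk => Or.inr hk)
      (mul_mem_nullPolys (rename_add_mem_nullPolys p ?_ (grothendieck_sub_prod_mem hq))
        fun k hk => rename_swap_prod_of_le hk.1 _)
    intro k hk
    have : k + 1 < q := hk
    exact ⟨by omega, by omega⟩
  convert add_mem h1 h2 using 1
  rw [map_sub]
  ring

end Products

namespace SVT

variable {lam mu nu : YoungDiagram} {p q : ℕ} {T : SVT nu.cells}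

/-- The two partitions formed by the content of `T`, split after `p` letters. -/
def splitContent (p q : ℕ) (T : SVT nu.cells) : YoungDiagram × YoungDiagram :=
  (ofRows p fun i => T.countFrom i 0, ofRows q fun i => T.countFrom (p + i) 0)

open Classical in
/-- The tableaux with entries below `p + q` satisfying the lattice condition for both blocks. -/
noncomputable def latticeSVT (nu : YoungDiagram) (p q : ℕ) : Finset (SVT nu.cells) :=
  (boundedSVT nu.cells (p + q)).filter fun T => ∀ t ∈ blockLetters p q, ∀ i j, ¬ T.Violates t i j

lemma mem_latticeSVT : T ∈ latticeSVT nu p q ↔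
    T.Bounded (p + q) ∧ ∀ t ∈ blockLetters p q, ∀ i j, ¬ T.Violates t i j := by
  simp [latticeSVT]

lemma rowLen_splitContent (hT : T ∈ latticeSVT nu p q) :
    (∀ i < p, (T.splitContent p q).1.rowLen i = T.countFrom i 0) ∧
      ∀ i < q, (T.splitContent p q).2.rowLen i = T.countFrom (p + i) 0 := by
  have h := (mem_latticeSVT.1 hT).2
  refine ⟨fun i hi => rowLen_ofRows (fun t ht => ?_) hi, fun i hi =>
    rowLen_ofRows (f := fun i => T.countFrom (p + i) 0) (fun t ht => ?_) hi⟩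
  · exact countFrom_succ_le_of_forall_not_violates fun i j _ => h t (Or.inl ht) i j
  · exact countFrom_succ_le_of_forall_not_violates fun i j _ =>
      h (p + t) (Or.inr ⟨by omega, by omega⟩) i j

lemma mem_latticeSVT_and_iff (hp : lam.colLen 0 ≤ p) (hq : mu.colLen 0 ≤ q) :
    T ∈ latticeSVT nu p q ∧ T.splitContent p q = (lam, mu) ↔ T.IsLR p q lam mu := by
  constructor
  · rintro ⟨hT, he⟩
    obtain ⟨c1, c2⟩ := rowLen_splitContent hT
    obtain ⟨h1, h2⟩ := mem_latticeSVT.1 hT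
    rw [he] at c1 c2
    refine ⟨fun t ht => h2 t (Or.inl ht), fun t ht ht' => h2 t (Or.inr ⟨ht, ht'⟩), fun i => ?_⟩
    split_ifs with hi
    · exact (c1 i hi).symm
    · rcases Nat.lt_or_ge i (p + q) with h3 | h3
      · rw [c2 (i - p) (by omega), show p + (i - p) = i by omega]
      · rw [rowLen_eq_zero (by omega), countFrom_eq_zero fun c hc => ?_]
        exact absurd (h1 c i hc) (by omega)
  · rintro ⟨h1, h2, h3⟩
    have hT : T ∈ latticeSVT nu p q := by
      refine mem_latticeSVT.2 ⟨fun c x hx => ?_, fun t ht => ?_⟩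
      · by_contra! hcon
        have h4 := countFrom_pos hx
        rw [h3, if_neg (by omega), rowLen_eq_zero (by omega)] at h4
        exact lt_irrefl _ h4
      · rcases ht with ht | ⟨ht, ht'⟩
        · exact h1 t ht
        · exact h2 t ht ht'
    obtain ⟨c1, c2⟩ := rowLen_splitContent hT
    refine ⟨hT, Prod.ext (eq_of_rowLen fun i => ?_) (eq_of_rowLen fun i => ?_)⟩
    · rcases Nat.lt_or_ge i p with hi | hi
      · rw [c1 i hi, h3, if_pos hi]
      · rw [rowLen_eq_zero (hp.trans hi)]
        exact rowLen_eq_zero (colLen_ofRows_le.trans hi)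
    · rcases Nat.lt_or_ge i q with hi | hi
      · rw [c2 i hi, h3, if_neg (by omega), show p + i - p = i by omega]
      · rw [rowLen_eq_zero (hq.trans hi)]
        exact rowLen_eq_zero (colLen_ofRows_le.trans hi)

lemma size_eq_of_mem_latticeSVT (hT : T ∈ latticeSVT nu p q) :
    T.size = (T.splitContent p q).1.card + (T.splitContent p q).2.card := by
  obtain ⟨c1, c2⟩ := rowLen_splitContent hT
  rw [(mem_latticeSVT.1 hT).1.size_eq, Finset.sum_range_add,
    card_eq_sum_rowLen (m := p) (lam := (T.splitContent p q).1) colLen_ofRows_le,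
    card_eq_sum_rowLen (m := q) (lam := (T.splitContent p q).2) colLen_ofRows_le]
  exact congrArg₂ _ (Finset.sum_congr rfl fun i hi => (c1 i (Finset.mem_range.1 hi)).symm)
    (Finset.sum_congr rfl fun i hi => (c2 i (Finset.mem_range.1 hi)).symm)

lemma monomial_eq_of_mem_latticeSVT (hT : T ∈ latticeSVT nu p q) :
    T.monomial = (∏ t ∈ Finset.range p, X t ^ (T.splitContent p q).1.rowLen t) *
      rename (· + p) (∏ t ∈ Finset.range q, X t ^ (T.splitContent p q).2.rowLen t) := by
  obtain ⟨c1, c2⟩ := rowLen_splitContent hT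
  rw [(mem_latticeSVT.1 hT).1.monomial_eq, Finset.prod_range_add, map_prod]
  refine congrArg₂ _ (Finset.prod_congr rfl fun i hi => ?_) (Finset.prod_congr rfl fun i hi => ?_)
  · rw [c1 i (Finset.mem_range.1 hi)]
  · rw [c2 i (Finset.mem_range.1 hi), map_pow, rename_X, add_comm]

end SVT

open Classical in
lemma dCoeff_smul_eq (lam mu nu : YoungDiagram) (p q : ℕ) :
    dCoeff lam mu nu •
        (grothendieck lam.cells p * rename (· + p) (grothendieck mu.cells q)) =
      ∑ T ∈ (latticeSVT nu p q).filter (fun T => T.splitContent p q = (lam, mu)),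
        (-1 : ℤ) ^ (T.size - nu.card) •
          (grothendieck (T.splitContent p q).1.cells p *
            rename (· + p) (grothendieck (T.splitContent p q).2.cells q)) := by
  have hconst : ∀ T ∈ (latticeSVT nu p q).filter (fun T => T.splitContent p q = (lam, mu)),
      (-1 : ℤ) ^ (T.size - nu.card) • (grothendieck (T.splitContent p q).1.cells p *
        rename (· + p) (grothendieck (T.splitContent p q).2.cells q)) =
      (-1 : ℤ) ^ (lam.card + mu.card - nu.card) •
        (grothendieck lam.cells p * rename (· + p) (grothendieck mu.cells q)) := by
    intro T hT
    obtain ⟨h1, h2⟩ := Finset.mem_filter.1 hT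
    rw [size_eq_of_mem_latticeSVT h1, h2]
  rw [Finset.sum_congr rfl hconst, Finset.sum_const]
  by_cases hp : lam.colLen 0 ≤ p
  · by_cases hq : mu.colLen 0 ≤ q
    · have hcard : Nat.card {T : SVT nu.cells // T.IsLR p q lam mu} =
          ((latticeSVT nu p q).filter (fun T => T.splitContent p q = (lam, mu))).card := by
        refine Nat.subtype_card _ fun T => ?_
        rw [Finset.mem_filter, mem_latticeSVT_and_iff hp hq]
      rw [dCoeff_eq hp hq, hcard, mul_comm, mul_smul, natCast_zsmul]
    · rw [grothendieck_eq_zero (lt_of_not_ge hq)]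
      simp
  · rw [grothendieck_eq_zero (lt_of_not_ge hp)]
    simp

lemma finsum_dCoeff_eq (nu : YoungDiagram) (p q : ℕ) :
    ∑ᶠ lm : YoungDiagram × YoungDiagram, dCoeff lm.1 lm.2 nu •
        (grothendieck lm.1.cells p * rename (· + p) (grothendieck lm.2.cells q)) =
      ∑ T ∈ latticeSVT nu p q, (-1 : ℤ) ^ (T.size - nu.card) •
          (grothendieck (T.splitContent p q).1.cells p *
            rename (· + p) (grothendieck (T.splitContent p q).2.cells q)) := by
  classical
  rw [finsum_eq_sum_of_support_subset (s := (latticeSVT nu p q).image (splitContent p q))]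
  · rw [← Finset.sum_fiberwise_of_maps_to
      (fun T hT => Finset.mem_image_of_mem (splitContent p q) hT)]
    refine Finset.sum_congr rfl fun lm _ => ?_
    rw [dCoeff_smul_eq]
  · intro lm hlm
    rw [Function.mem_support, dCoeff_smul_eq] at hlm
    obtain ⟨T, hT, -⟩ := Finset.exists_ne_zero_of_sum_ne_zero hlm
    obtain ⟨h1, h2⟩ := Finset.mem_filter.1 hT
    exact Finset.mem_coe.2 (Finset.mem_image.2 ⟨T, h1, h2⟩)

/-- **The coproduct rule in single-variable form** (Theorem 6.6): for every
partition `ν` and `p, q ≥ 1`,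
`G_ν(x_1,…,x_p,z_1,…,z_q) = Σ_{λ,μ} d^ν_{λμ} G_λ(x_1,…,x_p) G_μ(z_1,…,z_q)`
in `ℤ[x_1,…,x_p,z_1,…,z_q]`, where the `z`-variables are the variables
`p, p+1, …, p+q-1` (`0`-based). -/
theorem grothendieck_coproduct (nu : YoungDiagram) (p q : ℕ) (hp : 1 ≤ p) (hq : 1 ≤ q) :
    grothendieck nu.cells (p + q) =
      ∑ᶠ lm : YoungDiagram × YoungDiagram,
        dCoeff lm.1 lm.2 nu •
          (grothendieck lm.1.cells p *
            MvPolynomial.rename (· + p) (grothendieck lm.2.cells q)) := by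
  rw [finsum_dCoeff_eq, ← sub_eq_zero]
  refine eq_zero_of_mem_nullPolys (K := blockLetters p q) (m := p + q)
    (fun k => lt_of_mem_blockLetters) ?_ fun k hk => ?_
  · have h1 := grothendieck_sub_sum_mem nu (K := blockLetters p q) (m := p + q)
      fun k => lt_of_mem_blockLetters
    have h2 : ∑ T ∈ latticeSVT nu p q, (-1 : ℤ) ^ (T.size - nu.card) •
        (grothendieck (T.splitContent p q).1.cells p *
          rename (· + p) (grothendieck (T.splitContent p q).2.cells q) - T.monomial) ∈
        nullPolys (blockLetters p q) := by
      refine sum_mem fun T hT => zsmul_mem ?_ _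
      rw [monomial_eq_of_mem_latticeSVT hT]
      exact grothendieck_mul_sub_mem colLen_ofRows_le colLen_ofRows_le
    convert sub_mem h1 h2 using 1
    simp only [smul_sub, Finset.sum_sub_distrib]
    change _ = _ - ∑ T ∈ latticeSVT nu p q, T.weight -
      (_ - ∑ T ∈ latticeSVT nu p q, T.weight)
    abel
  · rw [map_sub, map_sum, rename_swap_grothendieck nu (lt_of_mem_blockLetters hk)]
    simp only [map_zsmul, rename_swap_grothendieck_mul hk]
end

section
/- (Variable-splitting formula) For partitions λ ⊆ ν and all integers p ≥ 1 and q ≥ 1, the identity G_{ν/λ}(x_1,…,x_{p+q}) = Σ (−1)^{|τ/σ|}·G_{τ/λ}(x_1,…,x_p)·G_{ν/σ}(x_{p+1},…,x_{p+q}) holds in ℤ[x_1,…,x_{p+q}], where the sum is over all pairs of partitions (σ,τ) with λ ⊆ σ ⊆ τ ⊆ ν such that τ/σ is a rook strip, and G_{ν/σ}(x_{p+1},…,x_{p+q}) denotes the polynomial G_{ν/σ} in q variables evaluated at x_{p+1},…,x_{p+q}. -/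
open MvPolynomial

theorem SVT.entry_injective {cells : Finset (ℕ × ℕ)} :
    Function.Injective (SVT.entry : SVT cells → ℕ × ℕ → Finset ℕ) := by
  rintro ⟨f, _, _, _, _⟩ ⟨g, _, _, _, _⟩ rfl
  rfl

/-- The entry functions of the set-valued tableaux on `cells` with entries below `m`. -/
def svtEntries (cells : Finset (ℕ × ℕ)) (m : ℕ) : Set (ℕ × ℕ → Finset ℕ) :=
  SVT.entry '' {T : SVT cells | T.Bounded m}

theorem mem_svtEntries {cells : Finset (ℕ × ℕ)} {m : ℕ} {f : ℕ × ℕ → Finset ℕ} :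
    f ∈ svtEntries cells m ↔
      (∀ c ∈ cells, (f c).Nonempty) ∧ (∀ c, c ∉ cells → f c = ∅) ∧
      (∀ i j, (i, j) ∈ cells → (i, j + 1) ∈ cells →
        ∀ a ∈ f (i, j), ∀ b ∈ f (i, j + 1), a ≤ b) ∧
      (∀ i j, (i, j) ∈ cells → (i + 1, j) ∈ cells →
        ∀ a ∈ f (i, j), ∀ b ∈ f (i + 1, j), a < b) ∧
      ∀ c, ∀ x ∈ f c, x < m := by
  constructor
  · rintro ⟨T, hT, rfl⟩
    exact ⟨T.nonempty_of_mem, T.eq_empty_of_not_mem, T.row_weak, T.col_strict, hT⟩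
  · rintro ⟨h₁, h₂, h₃, h₄, h₅⟩
    exact ⟨⟨f, h₁, h₂, h₃, h₄⟩, h₅, rfl⟩

theorem finite_svtEntries (cells : Finset (ℕ × ℕ)) (m : ℕ) : (svtEntries cells m).Finite := by
  let restrict (f : ℕ × ℕ → Finset ℕ) (c : cells) : Finset ℕ := f c
  have hfin : (Set.pi Set.univ fun _ : cells =>
      ((Finset.range m).powerset : Set (Finset ℕ))).Finite :=
    Set.Finite.pi fun _ => Finset.finite_toSet _
  refine Set.Finite.of_finite_image (f := restrict) (hfin.subset ?_) ?_
  · rintro _ ⟨f, hf, rfl⟩ c -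
    rw [mem_svtEntries] at hf
    simp only [Finset.mem_coe, Finset.mem_powerset]
    exact fun x hx => Finset.mem_range.2 (hf.2.2.2.2 c x hx)
  · intro f hf g hg hfg
    rw [mem_svtEntries] at hf hg
    funext c
    by_cases hc : c ∈ cells
    · exact congrFun hfg ⟨c, hc⟩
    · rw [hf.2.1 c hc, hg.2.1 c hc]

/-- The signed monomial of a filling `f` of `cells`. -/
noncomputable def svtWeight (cells : Finset (ℕ × ℕ)) (f : ℕ × ℕ → Finset ℕ) :
    MvPolynomial ℕ ℤ :=
  ((-1 : ℤ) ^ (∑ c ∈ cells, (f c).card - cells.card)) • ∏ c ∈ cells, ∏ i ∈ f c, X i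

theorem grothendieck_eq_sum (cells : Finset (ℕ × ℕ)) (m : ℕ) :
    grothendieck cells m = ∑ f ∈ (finite_svtEntries cells m).toFinset, svtWeight cells f := by
  rw [← finsum_mem_eq_finite_toFinset_sum, svtEntries,
    finsum_mem_image SVT.entry_injective.injOn]
  rfl

/-- The filling obtained from `f` and `g` by putting into every box the entries of `f` and the
entries of `g` shifted up by `p`. -/
def mergeFilling (p : ℕ) (f g : ℕ × ℕ → Finset ℕ) (c : ℕ × ℕ) : Finset ℕ :=
  f c ∪ (g c).map (addRightEmbedding p)

theorem mem_mergeFilling {p : ℕ} {f g : ℕ × ℕ → Finset ℕ} {c : ℕ × ℕ} {x : ℕ} :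
    x ∈ mergeFilling p f g c ↔ x ∈ f c ∨ ∃ y ∈ g c, y + p = x := by
  simp [mergeFilling]

theorem isRookStripCells_sdiff_iff {sig tau : YoungDiagram} :
    IsRookStripCells (tau.cells \ sig.cells) ↔
      (∀ i j, (i, j) ∉ sig → (i, j + 1) ∉ tau) ∧ (∀ i j, (i, j) ∉ sig → (i + 1, j) ∉ tau) := by
  simp only [IsRookStripCells, Finset.card_le_one, Finset.mem_filter, Finset.mem_sdiff,
    YoungDiagram.mem_cells]
  constructor
  · rintro ⟨hr, hc⟩
    constructor
    · intro i j hs ht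
      have := hr i (i, j) ⟨⟨tau.up_left_mem le_rfl (Nat.le_succ j) ht, hs⟩, rfl⟩ (i, j + 1)
        ⟨⟨ht, fun h => hs (sig.up_left_mem le_rfl (Nat.le_succ j) h)⟩, rfl⟩
      simp at this
    · intro i j hs ht
      have := hc j (i, j) ⟨⟨tau.up_left_mem (Nat.le_succ i) le_rfl ht, hs⟩, rfl⟩ (i + 1, j)
        ⟨⟨ht, fun h => hs (sig.up_left_mem (Nat.le_succ i) le_rfl h)⟩, rfl⟩
      simp at this
  · rintro ⟨hr, hc⟩
    constructor
    · rintro i ⟨a, j⟩ ⟨⟨h₁, h₂⟩, rfl⟩ ⟨a', j'⟩ ⟨⟨h₃, h₄⟩, h₅⟩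
      obtain rfl : a' = a := h₅
      rcases lt_trichotomy j j' with hj | rfl | hj
      · exact absurd (tau.up_left_mem le_rfl hj h₃) (hr _ _ h₂)
      · rfl
      · exact absurd (tau.up_left_mem le_rfl hj h₁) (hr _ _ h₄)
    · rintro j ⟨i, a⟩ ⟨⟨h₁, h₂⟩, rfl⟩ ⟨i', a'⟩ ⟨⟨h₃, h₄⟩, h₅⟩
      obtain rfl : a' = a := h₅
      rcases lt_trichotomy i i' with hi | rfl | hi
      · exact absurd (tau.up_left_mem hi le_rfl h₃) (hc _ _ h₂)
      · rfl
      · exact absurd (tau.up_left_mem hi le_rfl h₁) (hc _ _ h₄)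

section Merge

variable {lam nu sig tau : YoungDiagram} {p q : ℕ} {f g : ℕ × ℕ → Finset ℕ}

theorem mergeFilling_mem_svtEntries (hls : lam ≤ sig) (hst : sig ≤ tau) (htn : tau ≤ nu)
    (hrook : IsRookStripCells (tau.cells \ sig.cells))
    (hf : f ∈ svtEntries (tau.cells \ lam.cells) p)
    (hg : g ∈ svtEntries (nu.cells \ sig.cells) q) :
    mergeFilling p f g ∈ svtEntries (nu.cells \ lam.cells) (p + q) := by
  rw [isRookStripCells_sdiff_iff] at hrook
  rw [mem_svtEntries] at hf hg ⊢
  simp only [Finset.mem_sdiff, YoungDiagram.mem_cells] at hf hg ⊢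
  obtain ⟨f₁, f₂, f₃, f₄, f₅⟩ := hf
  obtain ⟨g₁, g₂, g₃, g₄, g₅⟩ := hg
  obtain ⟨hr, hc⟩ := hrook
  have memf : ∀ {c x}, x ∈ f c → c ∈ tau ∧ c ∉ lam := fun {c x} hx => by
    by_contra hcon
    simp [f₂ c hcon] at hx
  have memg : ∀ {c x}, x ∈ g c → c ∈ nu ∧ c ∉ sig := fun {c x} hx => by
    by_contra hcon
    simp [g₂ c hcon] at hx
  refine ⟨?_, ?_, ?_, ?_, ?_⟩
  · rintro c ⟨hn, hl⟩
    by_cases hs : c ∈ sig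
    · obtain ⟨x, hx⟩ := f₁ c ⟨hst hs, hl⟩
      exact ⟨x, mem_mergeFilling.2 (Or.inl hx)⟩
    · obtain ⟨x, hx⟩ := g₁ c ⟨hn, hs⟩
      exact ⟨x + p, mem_mergeFilling.2 (Or.inr ⟨x, hx, rfl⟩)⟩
  · intro c hcon
    refine Finset.eq_empty_of_forall_notMem fun x hx => hcon ?_
    rcases mem_mergeFilling.1 hx with hx | ⟨y, hy, -⟩
    · exact ⟨htn (memf hx).1, (memf hx).2⟩
    · exact ⟨(memg hy).1, fun h => (memg hy).2 (hls h)⟩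
  · intro i j _ _ a ha b hb
    rw [mem_mergeFilling] at ha hb
    rcases ha with ha | ⟨a, ha, rfl⟩ <;> rcases hb with hb | ⟨b, hb, rfl⟩
    · exact f₃ i j (memf ha) (memf hb) a ha b hb
    · exact (f₅ _ a ha).le.trans (Nat.le_add_left p b)
    · exact absurd (memf hb).1 (hr i j (memg ha).2)
    · exact Nat.add_le_add_right (g₃ i j (memg ha) (memg hb) a ha b hb) p
  · intro i j _ _ a ha b hb
    rw [mem_mergeFilling] at ha hb
    rcases ha with ha | ⟨a, ha, rfl⟩ <;> rcases hb with hb | ⟨b, hb, rfl⟩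
    · exact f₄ i j (memf ha) (memf hb) a ha b hb
    · exact (f₅ _ a ha).trans_le (Nat.le_add_left p b)
    · exact absurd (memf hb).1 (hc i j (memg ha).2)
    · exact Nat.add_lt_add_right (g₄ i j (memg ha) (memg hb) a ha b hb) p
  · intro c x hx
    rcases mem_mergeFilling.1 hx with hx | ⟨y, hy, rfl⟩
    · exact (f₅ c x hx).trans_le (Nat.le_add_right p q)
    · have := g₅ c y hy
      omega

theorem mem_left_iff_mem_mergeFilling {m : ℕ} {cells : Finset (ℕ × ℕ)}
    (hf : f ∈ svtEntries cells p) (c : ℕ × ℕ) :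
    m ∈ f c ↔ m ∈ mergeFilling p f g c ∧ m < p := by
  rw [mem_mergeFilling]
  constructor
  · exact fun h => ⟨Or.inl h, (mem_svtEntries.1 hf).2.2.2.2 c m h⟩
  · rintro ⟨h | ⟨y, -, rfl⟩, hlt⟩
    · exact h
    · omega

theorem mem_right_iff_mem_mergeFilling {m : ℕ} {cells : Finset (ℕ × ℕ)}
    (hf : f ∈ svtEntries cells p) (c : ℕ × ℕ) :
    m ∈ g c ↔ m + p ∈ mergeFilling p f g c := by
  rw [mem_mergeFilling]
  constructor
  · exact fun h => Or.inr ⟨m, h, rfl⟩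
  · rintro (h | ⟨y, hy, hym⟩)
    · have := (mem_svtEntries.1 hf).2.2.2.2 c _ h
      omega
    · obtain rfl : y = m := by omega
      exact hy

theorem mem_svtEntries_nonempty_iff {cells : Finset (ℕ × ℕ)} {m : ℕ}
    (hf : f ∈ svtEntries cells m) (c : ℕ × ℕ) : (f c).Nonempty ↔ c ∈ cells := by
  rw [mem_svtEntries] at hf
  refine ⟨fun h => ?_, hf.1 c⟩
  by_contra hc
  simp [hf.2.1 c hc] at h

theorem card_le_sum_card {cells : Finset (ℕ × ℕ)} {m : ℕ} (hf : f ∈ svtEntries cells m) :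
    cells.card ≤ ∑ c ∈ cells, (f c).card := by
  rw [Finset.card_eq_sum_ones]
  exact Finset.sum_le_sum fun c hc => ((mem_svtEntries.1 hf).1 c hc).card_pos

theorem svtWeight_mergeFilling (hls : lam ≤ sig) (hst : sig ≤ tau) (htn : tau ≤ nu)
    (hrook : IsRookStripCells (tau.cells \ sig.cells))
    (hf : f ∈ svtEntries (tau.cells \ lam.cells) p)
    (hg : g ∈ svtEntries (nu.cells \ sig.cells) q) :
    svtWeight (nu.cells \ lam.cells) (mergeFilling p f g) =
      ((-1 : ℤ) ^ (tau.card - sig.card)) •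
        (svtWeight (tau.cells \ lam.cells) f *
          rename (· + p) (svtWeight (nu.cells \ sig.cells) g)) := by
  have hF : ∀ c, c ∉ tau.cells \ lam.cells → f c = ∅ := (mem_svtEntries.1 hf).2.1
  have hG : ∀ c, c ∉ nu.cells \ sig.cells → g c = ∅ := (mem_svtEntries.1 hg).2.1
  have hsubF : tau.cells \ lam.cells ⊆ nu.cells \ lam.cells :=
    Finset.sdiff_subset_sdiff htn le_rfl
  have hsubG : nu.cells \ sig.cells ⊆ nu.cells \ lam.cells :=
    Finset.sdiff_subset_sdiff le_rfl hls
  have hdisj : ∀ c, Disjoint (f c) ((g c).map (addRightEmbedding p)) := fun c => by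
    rw [Finset.disjoint_left]
    intro x hx hx'
    obtain ⟨y, -, rfl⟩ := Finset.mem_map.1 hx'
    have := (mem_svtEntries.1 hf).2.2.2.2 c _ hx
    simp at this
  have hmerge := card_le_sum_card (mergeFilling_mem_svtEntries hls hst htn hrook hf hg)
  have hsum : ∑ c ∈ nu.cells \ lam.cells, (mergeFilling p f g c).card =
      ∑ c ∈ tau.cells \ lam.cells, (f c).card + ∑ c ∈ nu.cells \ sig.cells, (g c).card := by
    rw [Finset.sum_subset hsubF fun c _ hc => by simp [hF c hc],
      Finset.sum_subset hsubG fun c _ hc => by simp [hG c hc], ← Finset.sum_add_distrib]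
    exact Finset.sum_congr rfl fun c _ => by
      rw [mergeFilling, Finset.card_union_of_disjoint (hdisj c), Finset.card_map]
  have hprod : ∏ c ∈ nu.cells \ lam.cells, ∏ i ∈ mergeFilling p f g c,
        (X i : MvPolynomial ℕ ℤ) =
      (∏ c ∈ tau.cells \ lam.cells, ∏ i ∈ f c, X i) *
        ∏ c ∈ nu.cells \ sig.cells, ∏ i ∈ g c, X (i + p) := by
    rw [Finset.prod_subset hsubF fun c _ hc => by simp [hF c hc],
      Finset.prod_subset hsubG fun c _ hc => by simp [hG c hc], ← Finset.prod_mul_distrib]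
    exact Finset.prod_congr rfl fun c _ => by
      rw [mergeFilling, Finset.prod_union (hdisj c), Finset.prod_map]
      rfl
  have hexp : ∑ c ∈ nu.cells \ lam.cells, (mergeFilling p f g c).card -
        (nu.cells \ lam.cells).card =
      (tau.card - sig.card) +
        ((∑ c ∈ tau.cells \ lam.cells, (f c).card - (tau.cells \ lam.cells).card) +
          (∑ c ∈ nu.cells \ sig.cells, (g c).card - (nu.cells \ sig.cells).card)) := by
    have h₁ := card_le_sum_card hf
    have h₂ := card_le_sum_card hg
    have e₁ := Finset.card_sdiff_add_card_eq_card (hls.trans (hst.trans htn) : lam.cells ⊆ nu.cells)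
    have e₂ := Finset.card_sdiff_add_card_eq_card (hls.trans hst : lam.cells ⊆ tau.cells)
    have e₃ := Finset.card_sdiff_add_card_eq_card (hst.trans htn : sig.cells ⊆ nu.cells)
    have e₄ := Finset.card_le_card (hst : sig.cells ⊆ tau.cells)
    simp only [YoungDiagram.card]
    omega
  simp only [svtWeight, hexp, hprod, pow_add, map_zsmul, map_prod, rename_X, smul_mul_assoc,
    mul_smul_comm, smul_smul]
  congr 1
  ring

end Merge

/-- The Young diagram consisting of `lam` and the boxes of `nu` outside `lam` that satisfy `P`. -/
def YoungDiagram.extend (lam nu : YoungDiagram) (P : ℕ × ℕ → Prop)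
    [DecidablePred P]
    (hrow : ∀ i j, (i, j) ∉ lam → (i, j + 1) ∈ nu → P (i, j + 1) → P (i, j))
    (hcol : ∀ i j, (i, j) ∉ lam → (i + 1, j) ∈ nu → P (i + 1, j) → P (i, j)) :
    YoungDiagram where
  cells := nu.cells.filter fun c => c ∈ lam ∨ P c
  isLowerSet := by
    have step_row : ∀ i j k, (i, j + k) ∈ nu → ((i, j + k) ∈ lam ∨ P (i, j + k)) →
        ((i, j) ∈ lam ∨ P (i, j)) := by
      intro i j k
      induction k with
      | zero => exact fun _ h => h
      | succ k ih =>
        intro hn hP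
        refine ih (nu.up_left_mem le_rfl (by omega) hn) ?_
        by_cases hl : (i, j + k) ∈ lam
        · exact Or.inl hl
        · refine Or.inr (hrow i (j + k) hl hn (hP.resolve_left fun h' => hl ?_))
          exact lam.up_left_mem le_rfl (by omega) h'
    have step_col : ∀ i j k, (i + k, j) ∈ nu → ((i + k, j) ∈ lam ∨ P (i + k, j)) →
        ((i, j) ∈ lam ∨ P (i, j)) := by
      intro i j k
      induction k with
      | zero => exact fun _ h => h
      | succ k ih =>
        intro hn hP
        refine ih (nu.up_left_mem (by omega) le_rfl hn) ?_
        by_cases hl : (i + k, j) ∈ lam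
        · exact Or.inl hl
        · refine Or.inr (hcol (i + k) j hl hn (hP.resolve_left fun h' => hl ?_))
          exact lam.up_left_mem (by omega) le_rfl h'
    rintro ⟨i', j'⟩ ⟨i, j⟩ ⟨hi, hj⟩ hmem
    obtain ⟨k, rfl⟩ := Nat.exists_eq_add_of_le hi
    obtain ⟨l, rfl⟩ := Nat.exists_eq_add_of_le hj
    simp only [Finset.coe_filter, YoungDiagram.mem_cells, Set.mem_ofPred_eq] at hmem ⊢
    obtain ⟨hn, hP⟩ := hmem
    exact ⟨nu.up_left_mem hi hj hn,
      step_col i j k (nu.up_left_mem le_rfl hj hn) (step_row (i + k) j l hn hP)⟩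

theorem YoungDiagram.mem_extend {lam nu : YoungDiagram} {P : ℕ × ℕ → Prop}
    [DecidablePred P] {hrow hcol} {c : ℕ × ℕ} :
    c ∈ YoungDiagram.extend lam nu P hrow hcol ↔ c ∈ nu ∧ (c ∈ lam ∨ P c) := by
  rw [← YoungDiagram.mem_cells, YoungDiagram.extend, Finset.mem_filter, YoungDiagram.mem_cells]

theorem exists_mergeFilling_eq {lam nu : YoungDiagram} (h : lam ≤ nu) {p q : ℕ}
    {t : ℕ × ℕ → Finset ℕ} (ht : t ∈ svtEntries (nu.cells \ lam.cells) (p + q)) :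
    ∃ sig tau : YoungDiagram, ∃ f g : ℕ × ℕ → Finset ℕ,
      (lam ≤ sig ∧ sig ≤ tau ∧ tau ≤ nu ∧ IsRookStripCells (tau.cells \ sig.cells)) ∧
      f ∈ svtEntries (tau.cells \ lam.cells) p ∧
      g ∈ svtEntries (nu.cells \ sig.cells) q ∧ mergeFilling p f g = t := by
  classical
  rw [mem_svtEntries] at ht
  simp only [Finset.mem_sdiff, YoungDiagram.mem_cells] at ht
  obtain ⟨t₁, t₂, t₃, t₄, t₅⟩ := ht
  have memt : ∀ {c x}, x ∈ t c → c ∈ nu ∧ c ∉ lam := fun {c x} hx => by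
    by_contra hcon
    simp [t₂ c hcon] at hx
  have left_mem : ∀ {i j}, (i, j + 1) ∈ nu → (i, j) ∈ nu :=
    fun hn => nu.up_left_mem le_rfl (Nat.le_succ _) hn
  have up_mem : ∀ {i j}, (i + 1, j) ∈ nu → (i, j) ∈ nu :=
    fun hn => nu.up_left_mem (Nat.le_succ _) le_rfl hn
  have left_not_mem : ∀ {i j}, (i, j) ∉ lam → (i, j + 1) ∉ lam :=
    fun hl h' => hl (lam.up_left_mem le_rfl (Nat.le_succ _) h')
  have up_not_mem : ∀ {i j}, (i, j) ∉ lam → (i + 1, j) ∉ lam :=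
    fun hl h' => hl (lam.up_left_mem (Nat.le_succ _) le_rfl h')
  have row_lt : ∀ {i j}, (i, j) ∉ lam → (i, j + 1) ∈ nu → (∃ x ∈ t (i, j + 1), x < p) →
      ∀ x ∈ t (i, j), x < p := by
    rintro i j hl hn ⟨y, hy, hyp⟩ x hx
    exact (t₃ i j ⟨left_mem hn, hl⟩ ⟨hn, left_not_mem hl⟩ x hx y hy).trans_lt hyp
  have col_lt : ∀ {i j}, (i, j) ∉ lam → (i + 1, j) ∈ nu → (∃ x ∈ t (i + 1, j), x < p) →
      ∀ x ∈ t (i, j), x < p := by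
    rintro i j hl hn ⟨y, hy, hyp⟩ x hx
    exact (t₄ i j ⟨up_mem hn, hl⟩ ⟨hn, up_not_mem hl⟩ x hx y hy).trans hyp
  have exists_lt : ∀ {c}, c ∈ nu → c ∉ lam → (∀ x ∈ t c, x < p) → ∃ x ∈ t c, x < p := by
    intro c hn hl hx
    obtain ⟨x, hxt⟩ := t₁ c ⟨hn, hl⟩
    exact ⟨x, hxt, hx x hxt⟩
  let sig : YoungDiagram := YoungDiagram.extend lam nu (fun c => ∀ x ∈ t c, x < p)
    (fun i j hl hn hP => row_lt hl hn (exists_lt hn (left_not_mem hl) hP))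
    (fun i j hl hn hP => col_lt hl hn (exists_lt hn (up_not_mem hl) hP))
  let tau : YoungDiagram := YoungDiagram.extend lam nu (fun c => ∃ x ∈ t c, x < p)
    (fun i j hl hn hP => exists_lt (left_mem hn) hl (row_lt hl hn hP))
    (fun i j hl hn hP => exists_lt (up_mem hn) hl (col_lt hl hn hP))
  have mem_sig : ∀ c, c ∈ sig ↔ c ∈ nu ∧ (c ∈ lam ∨ ∀ x ∈ t c, x < p) :=
    fun c => YoungDiagram.mem_extend
  have mem_tau : ∀ c, c ∈ tau ↔ c ∈ nu ∧ (c ∈ lam ∨ ∃ x ∈ t c, x < p) :=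
    fun c => YoungDiagram.mem_extend
  let f : ℕ × ℕ → Finset ℕ := fun c => (t c).filter (· < p)
  let g : ℕ × ℕ → Finset ℕ := fun c => ((t c).filter (p ≤ ·)).image (· - p)
  have mem_f : ∀ {c x}, x ∈ f c ↔ x ∈ t c ∧ x < p := by simp [f]
  have mem_g : ∀ {c x}, x ∈ g c ↔ x + p ∈ t c := by
    intro c x
    simp only [g, Finset.mem_image, Finset.mem_filter]
    constructor
    · rintro ⟨y, ⟨hy, hpy⟩, rfl⟩
      rwa [Nat.sub_add_cancel hpy]
    · exact fun hx => ⟨x + p, ⟨hx, Nat.le_add_left p x⟩, Nat.add_sub_cancel x p⟩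
  refine ⟨sig, tau, f, g, ⟨fun c hc => ?_, fun c hc => ?_, fun c hc => ?_, ?_⟩, ?_, ?_, ?_⟩
  · exact (mem_sig c).2 ⟨h hc, Or.inl hc⟩
  · obtain ⟨hn, hP⟩ := (mem_sig c).1 hc
    refine (mem_tau c).2 ⟨hn, or_iff_not_imp_left.2 fun hl => ?_⟩
    exact exists_lt hn hl (hP.resolve_left hl)
  · exact ((mem_tau c).1 hc).1
  · rw [isRookStripCells_sdiff_iff]
    constructor
    · intro i j hs htau
      obtain ⟨hn, hP⟩ := (mem_tau _).1 htau
      refine hs ((mem_sig _).2 ⟨left_mem hn, or_iff_not_imp_left.2 fun hl => ?_⟩)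
      exact row_lt hl hn (hP.resolve_left (left_not_mem hl))
    · intro i j hs htau
      obtain ⟨hn, hP⟩ := (mem_tau _).1 htau
      refine hs ((mem_sig _).2 ⟨up_mem hn, or_iff_not_imp_left.2 fun hl => ?_⟩)
      exact col_lt hl hn (hP.resolve_left (up_not_mem hl))
  · rw [mem_svtEntries]
    simp only [Finset.mem_sdiff, YoungDiagram.mem_cells]
    refine ⟨?_, ?_, ?_, ?_, fun c x hx => (mem_f.1 hx).2⟩
    · rintro c ⟨htau, hl⟩
      obtain ⟨x, hx, hxp⟩ := ((mem_tau c).1 htau).2.resolve_left hl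
      exact ⟨x, mem_f.2 ⟨hx, hxp⟩⟩
    · intro c hcon
      refine Finset.eq_empty_of_forall_notMem fun x hx => hcon ?_
      obtain ⟨hxt, hxp⟩ := mem_f.1 hx
      exact ⟨(mem_tau c).2 ⟨(memt hxt).1, Or.inr ⟨x, hxt, hxp⟩⟩, (memt hxt).2⟩
    · intro i j _ _ a ha b hb
      have ha := (mem_f.1 ha).1
      have hb := (mem_f.1 hb).1
      exact t₃ i j (memt ha) (memt hb) a ha b hb
    · intro i j _ _ a ha b hb
      have ha := (mem_f.1 ha).1
      have hb := (mem_f.1 hb).1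
      exact t₄ i j (memt ha) (memt hb) a ha b hb
  · rw [mem_svtEntries]
    simp only [Finset.mem_sdiff, YoungDiagram.mem_cells]
    refine ⟨?_, ?_, ?_, ?_, ?_⟩
    · rintro c ⟨hn, hs⟩
      have hs : c ∉ lam ∧ ∃ x ∈ t c, p ≤ x := by
        simpa [mem_sig, hn] using hs
      obtain ⟨-, x, hx, hpx⟩ := hs
      exact ⟨x - p, mem_g.2 (by rwa [Nat.sub_add_cancel hpx])⟩
    · intro c hcon
      refine Finset.eq_empty_of_forall_notMem fun x hx => hcon ?_
      have hx := mem_g.1 hx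
      refine ⟨(memt hx).1, fun hs => ?_⟩
      have := ((mem_sig c).1 hs).2.resolve_left (memt hx).2 _ hx
      omega
    · intro i j _ _ a ha b hb
      have ha := mem_g.1 ha
      have hb := mem_g.1 hb
      have := t₃ i j (memt ha) (memt hb) _ ha _ hb
      omega
    · intro i j _ _ a ha b hb
      have ha := mem_g.1 ha
      have hb := mem_g.1 hb
      have := t₄ i j (memt ha) (memt hb) _ ha _ hb
      omega
    · intro c x hx
      have := t₅ c _ (mem_g.1 hx)
      omega
  · funext c
    ext x
    rw [mem_mergeFilling]
    constructor
    · rintro (hx | ⟨y, hy, rfl⟩)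
      · exact (mem_f.1 hx).1
      · exact mem_g.1 hy
    · intro hx
      rcases lt_or_ge x p with hxp | hpx
      · exact Or.inl (mem_f.2 ⟨hx, hxp⟩)
      · exact Or.inr ⟨x - p, mem_g.2 (by rwa [Nat.sub_add_cancel hpx]), Nat.sub_add_cancel hpx⟩

theorem YoungDiagram.finite_Iic (nu : YoungDiagram) : (Set.Iic nu).Finite := by
  refine Set.Finite.of_finite_image (f := YoungDiagram.cells)
    (nu.cells.powerset.finite_toSet.subset ?_) ?_
  · rintro _ ⟨mu, hmu, rfl⟩
    exact Finset.mem_coe.2 (Finset.mem_powerset.2 hmu)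
  · exact fun a _ b _ hab => YoungDiagram.ext hab

theorem YoungDiagram.eq_of_sdiff_eq {lam mu mu' : YoungDiagram} (h : lam ≤ mu) (h' : lam ≤ mu')
    (heq : ∀ c, c ∈ mu.cells \ lam.cells ↔ c ∈ mu'.cells \ lam.cells) : mu = mu' := by
  refine YoungDiagram.ext ?_
  rw [← Finset.sdiff_union_of_subset (h : lam.cells ⊆ mu.cells),
    ← Finset.sdiff_union_of_subset (h' : lam.cells ⊆ mu'.cells), Finset.ext heq]

theorem YoungDiagram.eq_of_eq_sdiff {nu mu mu' : YoungDiagram} (h : mu ≤ nu) (h' : mu' ≤ nu)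
    (heq : ∀ c, c ∈ nu.cells \ mu.cells ↔ c ∈ nu.cells \ mu'.cells) : mu = mu' := by
  refine YoungDiagram.ext ?_
  rw [← Finset.sdiff_sdiff_eq_self (h : mu.cells ⊆ nu.cells),
    ← Finset.sdiff_sdiff_eq_self (h' : mu'.cells ⊆ nu.cells), Finset.ext heq]

/-- **Variable splitting** (Lemma 6.1): for partitions `λ ⊆ ν` and `p, q ≥ 1`,
`G_{ν/λ}(x_1,…,x_{p+q}) = Σ (-1)^{|τ/σ|} G_{τ/λ}(x_1,…,x_p) G_{ν/σ}(x_{p+1},…,x_{p+q})`,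
the sum being over all pairs of partitions `(σ, τ)` with `λ ⊆ σ ⊆ τ ⊆ ν` such
that `τ/σ` is a rook strip. -/
theorem grothendieck_variable_splitting (lam nu : YoungDiagram) (h : lam ≤ nu)
    (p q : ℕ) (hp : 1 ≤ p) (hq : 1 ≤ q) :
    grothendieck (nu.cells \ lam.cells) (p + q) =
      ∑ᶠ (st : YoungDiagram × YoungDiagram)
        (_ : lam ≤ st.1 ∧ st.1 ≤ st.2 ∧ st.2 ≤ nu ∧
          IsRookStripCells (st.2.cells \ st.1.cells)),
        ((-1 : ℤ) ^ (st.2.card - st.1.card)) •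
          (grothendieck (st.2.cells \ lam.cells) p *
            MvPolynomial.rename (· + p) (grothendieck (nu.cells \ st.1.cells) q)) := by
  have hfin : {st : YoungDiagram × YoungDiagram | lam ≤ st.1 ∧ st.1 ≤ st.2 ∧ st.2 ≤ nu ∧
      IsRookStripCells (st.2.cells \ st.1.cells)}.Finite :=
    (nu.finite_Iic.prod nu.finite_Iic).subset fun st hst =>
      ⟨hst.2.1.trans hst.2.2.1, hst.2.2.1⟩
  refine Eq.trans ?_ (finsum_mem_eq_finite_toFinset_sum _ hfin).symm
  simp only [grothendieck_eq_sum, map_sum, Finset.sum_mul_sum, Finset.smul_sum]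
  simp only [← Finset.sum_product']
  rw [Finset.sum_sigma']
  symm
  refine Finset.sum_bij (fun x _ => mergeFilling p x.2.1 x.2.2) ?_ ?_ ?_ ?_
  · rintro ⟨⟨sig, tau⟩, f, g⟩ hx
    simp only [Finset.mem_sigma, Finset.mem_product, Set.Finite.mem_toFinset,
      Set.mem_ofPred_eq] at hx ⊢
    obtain ⟨⟨h₁, h₂, h₃, h₄⟩, hf, hg⟩ := hx
    exact mergeFilling_mem_svtEntries h₁ h₂ h₃ h₄ hf hg
  · rintro ⟨⟨sig, tau⟩, f, g⟩ hx ⟨⟨sig', tau'⟩, f', g'⟩ hx' heq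
    simp only [Finset.mem_sigma, Finset.mem_product, Set.Finite.mem_toFinset,
      Set.mem_ofPred_eq] at hx hx' heq
    obtain ⟨⟨h₁, h₂, h₃, h₄⟩, hf, hg⟩ := hx
    obtain ⟨⟨h₁', h₂', h₃', h₄'⟩, hf', hg'⟩ := hx'
    obtain rfl : f = f' := by
      funext c
      ext x
      rw [mem_left_iff_mem_mergeFilling hf c, heq, ← mem_left_iff_mem_mergeFilling hf' c]
    obtain rfl : g = g' := by
      funext c
      ext x
      rw [mem_right_iff_mem_mergeFilling hf c, heq, ← mem_right_iff_mem_mergeFilling hf' c]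
    obtain rfl : tau = tau' := YoungDiagram.eq_of_sdiff_eq (h₁.trans h₂) (h₁'.trans h₂')
      fun c => by rw [← mem_svtEntries_nonempty_iff hf, ← mem_svtEntries_nonempty_iff hf']
    obtain rfl : sig = sig' := YoungDiagram.eq_of_eq_sdiff (h₂.trans h₃) (h₂'.trans h₃)
      fun c => by rw [← mem_svtEntries_nonempty_iff hg, ← mem_svtEntries_nonempty_iff hg']
    rfl
  · intro t ht
    rw [Set.Finite.mem_toFinset] at ht
    obtain ⟨sig, tau, f, g, hst, hf, hg, rfl⟩ := exists_mergeFilling_eq h ht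
    refine ⟨⟨(sig, tau), f, g⟩, ?_, rfl⟩
    simp only [Finset.mem_sigma, Finset.mem_product, Set.Finite.mem_toFinset, Set.mem_ofPred_eq]
    exact ⟨hst, hf, hg⟩
  · rintro ⟨⟨sig, tau⟩, f, g⟩ hx
    simp only [Finset.mem_sigma, Finset.mem_product, Set.Finite.mem_toFinset,
      Set.mem_ofPred_eq] at hx
    obtain ⟨⟨h₁, h₂, h₃, h₄⟩, hf, hg⟩ := hx
    exact (svtWeight_mergeFilling h₁ h₂ h₃ h₄ hf hg).symm
end
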